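/- arXiv:2404.08922 — 4 statements merged into one kernel-verified Lean document; each statement's English description precedes it below -/
import Mathlib

section
/- Let t be a rational number with t ≠ 1 and t ≠ 2, let α ∈ ℂ be a root of f_t, and set β = a₀ + a₁α + a₂α² + a₃α³ + a₄α⁴ + a₅α⁵. Then the six ordered pairs (α,β), (β,α), (1/α, β/α), (β/α, 1/α), (1/β, α/β), (α/β, 1/β) are pairwise distinct, and each pair (x,y) among them satisfies x⁵ + y⁵ + 1 = 0 with x ≠ 0 and y ≠ 0; that is, they give six distinct non-trivial points [x,y,1] of the Fermat quintic x⁵ + y⁵ + z⁵ = 0 rational over ℚ(α). -/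
open Polynomial IntermediateField

noncomputable def u (t : ℚ) : ℚ := (3*t^2 - 2*t + 2) / (t^2 + t - 1)

noncomputable def v (t : ℚ) : ℚ :=
  (t^5 - 5*t^4 + 10*t^3 - 20*t^2 + 15*t - 7) / ((t - 2) * (t^2 + t - 1)^2)

noncomputable def w (t : ℚ) : ℚ :=
  (-3*t^5 + 10*t^4 - 20*t^3 + 20*t^2 - 20*t + 6) / ((t - 2) * (t^2 + t - 1)^2)

/-- The polynomial `f_t = X⁶ + uX⁵ + vX⁴ + wX³ + vX² + uX + 1 ∈ ℚ[X]`. -/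
noncomputable def f (t : ℚ) : Polynomial ℚ :=
  X^6 + C (u t) * X^5 + C (v t) * X^4 + C (w t) * X^3 + C (v t) * X^2 + C (u t) * X + 1

noncomputable def s (t : ℚ) : ℚ := (t^4 - 3*t^3 - t^2 + 3*t + 1) * (t - 2)

noncomputable def a0 (t : ℚ) : ℚ := -((t^2 + 1) * (t^3 - t^2 + 2*t - 3)) / s t

noncomputable def a1 (t : ℚ) : ℚ :=
  -(3*t^7 - 9*t^6 + 16*t^5 - 15*t^4 + 10*t^3 - 11*t^2 + 8*t - 7) / ((t^2 + t - 1) * s t)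

noncomputable def a2 (t : ℚ) : ℚ :=
  (2*t^8 - 14*t^7 + 52*t^6 - 99*t^5 + 100*t^4 - 54*t^3 + 38*t^2 - 44*t + 13) /
    ((t^2 + t - 1) * (t - 2) * s t)

noncomputable def a3 (t : ℚ) : ℚ :=
  (t^8 + t^7 - 21*t^6 + 65*t^5 - 90*t^4 + 78*t^3 - 57*t^2 + 32*t - 15) /
    ((t^2 + t - 1) * (t - 2) * s t)

noncomputable def a4 (t : ℚ) : ℚ := -(2*t^5 - 6*t^4 + 13*t^3 - 14*t^2 + 7*t - 5) / s t

noncomputable def a5 (t : ℚ) : ℚ := -((t^2 + t - 1) * (t^3 - t^2 + 2*t - 3)) / s t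


lemma quad_ne (t : ℚ) : (-1)*t^0 + (1)*t^1 + (1)*t^2 ≠ 0 := by
  intro h
  have key : ∀ x y : ZMod 2, (-1)*x^0*y^2 + (1)*x^1*y^1 + (1)*x^2*y^0 = 0 → x = 0 ∧ y = 0 := by decide
  have hm : (t.den : ℚ) ≠ 0 := by exact_mod_cast t.den_nz
  have ht : t * t.den = t.num := Rat.mul_den_eq_num t
  have hx : ∃ x y : ℤ, x = t.num ∧ y = t.den ∧ (-1)*x^0*y^2 + (1)*x^1*y^1 + (1)*x^2*y^0 = 0 := by
    refine ⟨t.num, t.den, rfl, rfl, ?_⟩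
    have : (((-1)*(t.num:ℚ)^0*(t.den:ℚ)^2 + (1)*(t.num:ℚ)^1*(t.den:ℚ)^1 + (1)*(t.num:ℚ)^2*(t.den:ℚ)^0) : ℚ) = 0 := by
      rw [← ht]
      linear_combination (t.den : ℚ)^2 * h
    exact_mod_cast this
  obtain ⟨x, y, hx, hy, h0⟩ := hx
  have h3 := congrArg (Int.cast : ℤ → ZMod 2) h0
  push_cast at h3
  obtain ⟨h4, h5⟩ := key _ _ h3
  rw [ZMod.intCast_zmod_eq_zero_iff_dvd] at h4 h5
  rw [hx] at h4
  rw [hy] at h5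
  have h6 := Int.natCast_dvd.mp h4
  have h7 : 2 ∣ t.den := by exact_mod_cast h5
  have h8 := Nat.dvd_gcd h6 h7
  rw [Nat.Coprime.gcd_eq_one t.reduced] at h8
  omega

lemma quart_ne (t : ℚ) : (1)*t^0 + (3)*t^1 + (-1)*t^2 + (-3)*t^3 + (1)*t^4 ≠ 0 := by
  intro h
  have key : ∀ x y : ZMod 2, (1)*x^0*y^4 + (3)*x^1*y^3 + (-1)*x^2*y^2 + (-3)*x^3*y^1 + (1)*x^4*y^0 = 0 → x = 0 ∧ y = 0 := by decide
  have hm : (t.den : ℚ) ≠ 0 := by exact_mod_cast t.den_nz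
  have ht : t * t.den = t.num := Rat.mul_den_eq_num t
  have hx : ∃ x y : ℤ, x = t.num ∧ y = t.den ∧ (1)*x^0*y^4 + (3)*x^1*y^3 + (-1)*x^2*y^2 + (-3)*x^3*y^1 + (1)*x^4*y^0 = 0 := by
    refine ⟨t.num, t.den, rfl, rfl, ?_⟩
    have : (((1)*(t.num:ℚ)^0*(t.den:ℚ)^4 + (3)*(t.num:ℚ)^1*(t.den:ℚ)^3 + (-1)*(t.num:ℚ)^2*(t.den:ℚ)^2 + (-3)*(t.num:ℚ)^3*(t.den:ℚ)^1 + (1)*(t.num:ℚ)^4*(t.den:ℚ)^0) : ℚ) = 0 := by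
      rw [← ht]
      linear_combination (t.den : ℚ)^4 * h
    exact_mod_cast this
  obtain ⟨x, y, hx, hy, h0⟩ := hx
  have h3 := congrArg (Int.cast : ℤ → ZMod 2) h0
  push_cast at h3
  obtain ⟨h4, h5⟩ := key _ _ h3
  rw [ZMod.intCast_zmod_eq_zero_iff_dvd] at h4 h5
  rw [hx] at h4
  rw [hy] at h5
  have h6 := Int.natCast_dvd.mp h4
  have h7 : 2 ∣ t.den := by exact_mod_cast h5
  have h8 := Nat.dvd_gcd h6 h7
  rw [Nat.Coprime.gcd_eq_one t.reduced] at h8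
  omega

lemma disc_ne (t : ℚ) : (4)*t^0 + (20)*t^3 + (10)*t^4 + (-7)*t^5 ≠ 0 := by
  intro h
  have key : ∀ x y : ZMod 11, (4)*x^0*y^5 + (20)*x^3*y^2 + (10)*x^4*y^1 + (-7)*x^5*y^0 = 0 → x = 0 ∧ y = 0 := by decide
  have hm : (t.den : ℚ) ≠ 0 := by exact_mod_cast t.den_nz
  have ht : t * t.den = t.num := Rat.mul_den_eq_num t
  have hx : ∃ x y : ℤ, x = t.num ∧ y = t.den ∧ (4)*x^0*y^5 + (20)*x^3*y^2 + (10)*x^4*y^1 + (-7)*x^5*y^0 = 0 := by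
    refine ⟨t.num, t.den, rfl, rfl, ?_⟩
    have : (((4)*(t.num:ℚ)^0*(t.den:ℚ)^5 + (20)*(t.num:ℚ)^3*(t.den:ℚ)^2 + (10)*(t.num:ℚ)^4*(t.den:ℚ)^1 + (-7)*(t.num:ℚ)^5*(t.den:ℚ)^0) : ℚ) = 0 := by
      rw [← ht]
      linear_combination (t.den : ℚ)^5 * h
    exact_mod_cast this
  obtain ⟨x, y, hx, hy, h0⟩ := hx
  have h3 := congrArg (Int.cast : ℤ → ZMod 11) h0
  push_cast at h3
  obtain ⟨h4, h5⟩ := key _ _ h3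
  rw [ZMod.intCast_zmod_eq_zero_iff_dvd] at h4 h5
  rw [hx] at h4
  rw [hy] at h5
  have h6 := Int.natCast_dvd.mp h4
  have h7 : 11 ∣ t.den := by exact_mod_cast h5
  have h8 := Nat.dvd_gcd h6 h7
  rw [Nat.Coprime.gcd_eq_one t.reduced] at h8
  omega

lemma rel1 (T a b : ℂ) (hF : ((T-2)*(T^2+T-1)^2*(a^6+1) + (3*T^2-2*T+2)*((T-2)*(T^2+T-1))*(a^5+a) + (T^5 - 5*T^4 + 10*T^3 - 20*T^2 + 15*T - 7)*(a^4+a^2) + (-3*T^5 + 10*T^4 - 20*T^3 + 20*T^2 - 20*T + 6)*a^3) = 0)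
    (hb : b = (-((T^2 + 1) * (T^3 - T^2 + 2*T - 3))*((T^2+T-1)*(T-2))
      - (3*T^7 - 9*T^6 + 16*T^5 - 15*T^4 + 10*T^3 - 11*T^2 + 8*T - 7)*(T-2)*a
      + (2*T^8 - 14*T^7 + 52*T^6 - 99*T^5 + 100*T^4 - 54*T^3 + 38*T^2 - 44*T + 13)*a^2
      + (T^8 + T^7 - 21*T^6 + 65*T^5 - 90*T^4 + 78*T^3 - 57*T^2 + 32*T - 15)*a^3
      - (2*T^5 - 6*T^4 + 13*T^3 - 14*T^2 + 7*T - 5)*((T^2+T-1)*(T-2))*a^4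
      - ((T^2 + T - 1) * (T^3 - T^2 + 2*T - 3))*((T^2+T-1)*(T-2))*a^5)) :
    (T-2)*((T^2+T-1)*(T-2)*((T^4 - 3*T^3 - T^2 + 3*T + 1)*(T-2)))*(((T^2+T-1)*(T-2)*((T^4 - 3*T^3 - T^2 + 3*T + 1)*(T-2)))*a+b+a*b) + (((T^2+T-1)*(T-2)*((T^4 - 3*T^3 - T^2 + 3*T + 1)*(T-2)))*(1+a)+b)^2 = 0 := by
  subst hb
  linear_combination (((-26)*T^0 + (9)*T^1 + (-42)*T^2 + (196)*T^3 + (-127)*T^4 + (-120)*T^5 + (68)*T^6 + (163)*T^7 + (-203)*T^8 + (111)*T^9 + (-41)*T^10 + (10)*T^11 + (-1)*T^12)*a^0 +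
      ((32)*T^0 + (-116)*T^1 + (72)*T^2 + (-9)*T^3 + (163)*T^4 + (-378)*T^5 + (488)*T^6 + (-446)*T^7 + (262)*T^8 + (-84)*T^9 + (11)*T^10)*a^1 +
      ((-29)*T^0 + (46)*T^1 + (-98)*T^2 + (251)*T^3 + (-442)*T^4 + (523)*T^5 + (-439)*T^6 + (264)*T^7 + (-93)*T^8 + (6)*T^9 + (7)*T^10 + (-2)*T^11)*a^2 +
      ((24)*T^0 + (-76)*T^1 + (150)*T^2 + (-285)*T^3 + (315)*T^4 + (-169)*T^5 + (36)*T^6 + (25)*T^7 + (-45)*T^8 + (30)*T^9 + (-9)*T^10 + (1)*T^11)*a^3 +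
      ((-18)*T^0 + (69)*T^1 + (-80)*T^2 + (25)*T^3 + (-12)*T^5 + (26)*T^6 + (-10)*T^7 + (-2)*T^10 + (1)*T^11)*a^4 +
      (0)*a^5) * hF

lemma rel2 (T a b : ℂ) (hF : ((T-2)*(T^2+T-1)^2*(a^6+1) + (3*T^2-2*T+2)*((T-2)*(T^2+T-1))*(a^5+a) + (T^5 - 5*T^4 + 10*T^3 - 20*T^2 + 15*T - 7)*(a^4+a^2) + (-3*T^5 + 10*T^4 - 20*T^3 + 20*T^2 - 20*T + 6)*a^3) = 0)
    (hb : b = (-((T^2 + 1) * (T^3 - T^2 + 2*T - 3))*((T^2+T-1)*(T-2))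
      - (3*T^7 - 9*T^6 + 16*T^5 - 15*T^4 + 10*T^3 - 11*T^2 + 8*T - 7)*(T-2)*a
      + (2*T^8 - 14*T^7 + 52*T^6 - 99*T^5 + 100*T^4 - 54*T^3 + 38*T^2 - 44*T + 13)*a^2
      + (T^8 + T^7 - 21*T^6 + 65*T^5 - 90*T^4 + 78*T^3 - 57*T^2 + 32*T - 15)*a^3
      - (2*T^5 - 6*T^4 + 13*T^3 - 14*T^2 + 7*T - 5)*((T^2+T-1)*(T-2))*a^4
      - ((T^2 + T - 1) * (T^3 - T^2 + 2*T - 3))*((T^2+T-1)*(T-2))*a^5)) :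
    5*(T-1)*((T^2+T-1)*(T-2)*((T^4 - 3*T^3 - T^2 + 3*T + 1)*(T-2)))*(a*b) - (T^2+T-1)*((((T^2+T-1)*(T-2)*((T^4 - 3*T^3 - T^2 + 3*T + 1)*(T-2)))*(1+a)+b)*(((T^2+T-1)*(T-2)*((T^4 - 3*T^3 - T^2 + 3*T + 1)*(T-2)))*a+b+a*b)) = 0 := by
  subst hb
  linear_combination (T^2+T-1) * (((6)*T^0 + (-49)*T^1 + (113)*T^2 + (-131)*T^3 + (127)*T^4 + (-80)*T^5 + (7)*T^6 + (16)*T^7 + (-17)*T^8 + (14)*T^9 + (-4)*T^10)*a^0 +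
      ((6)*T^0 + (99)*T^1 + (-119)*T^2 + (-42)*T^3 + (-26)*T^4 + (336)*T^5 + (-418)*T^6 + (217)*T^7 + (-44)*T^8 + (-7)*T^9 + (8)*T^10 + (-2)*T^11)*a^1 +
      ((-3)*T^0 + (70)*T^1 + (26)*T^2 + (-242)*T^3 + (279)*T^4 + (-145)*T^5 + (-49)*T^6 + (182)*T^7 + (-169)*T^8 + (78)*T^9 + (-18)*T^10 + (2)*T^11)*a^2 +
      ((5)*T^0 + (30)*T^1 + (-52)*T^2 + (34)*T^3 + (127)*T^4 + (-354)*T^5 + (403)*T^6 + (-289)*T^7 + (138)*T^8 + (-36)*T^9 + (2)*T^10 + (1)*T^11)*a^3 +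
      ((-6)*T^0 + (7)*T^1 + (-70)*T^2 + (260)*T^3 + (-315)*T^4 + (181)*T^5 + (-62)*T^6 + (-15)*T^7 + (45)*T^8 + (-30)*T^9 + (11)*T^10 + (-2)*T^11)*a^4 +
      ((18)*T^0 + (-69)*T^1 + (80)*T^2 + (-25)*T^3 + (12)*T^5 + (-26)*T^6 + (10)*T^7 + (2)*T^10 + (-1)*T^11)*a^5) * hF

lemma core_fermat (T a b : ℂ) (hT : T - 1 ≠ 0)
    (G1 : (T-2)*(a+b+a*b) + (1+a+b)^2 = 0)
    (G2 : 5*(T-1)*(a*b) - (T^2+T-1)*((1+a+b)*(a+b+a*b)) = 0) : a^5 + b^5 + 1 = 0 := by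
  have : (T-1) * (a^5 + b^5 + 1) = 0 := by
    linear_combination ((1+a+b)*((T-1)*(1+a+b)^2 - (T-2)*(a+b+a*b))) * G1
      + ((1+a+b)^2 - (a+b+a*b)) * G2
  exact (mul_eq_zero.mp this).resolve_left hT

lemma core_disc (T a b : ℂ)
    (G1 : (T-2)*(a+b+a*b) + (1+a+b)^2 = 0)
    (G2 : 5*(T-1)*(a*b) - (T^2+T-1)*((1+a+b)*(a+b+a*b)) = 0) :
    25*(T-1)^2*((a-b)*(a-1)*(b-1))^2
      = -((a+b+a*b)^3*(4 + 20*T^3 + 10*T^4 - 7*T^5)) := by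
  linear_combination (25*(T-1)^2*(a+b+a*b)^2
      - 20*(T-1)*(T^2+T-1)*(a+b+a*b)*((1+a+b)^2-(T-2)*(a+b+a*b))
      + 90*(T-1)*(T^2+T-1)*(a+b+a*b)^2 - 27*(T^2+T-1)^2*(a+b+a*b)^2) * G1
    + (-20*(T-1)*(1+a+b)^3 + 90*(T-1)*(1+a+b)*(a+b+a*b)
      - 27*(5*(T-1)*(a*b) + (T^2+T-1)*((1+a+b)*(a+b+a*b)))) * G2

/-- If `t ≠ 1, 2` is rational, `α ∈ ℂ` a root of `f t` and
`β = a₀ + a₁α + ⋯ + a₅α⁵`, then the six pairs `(α,β), (β,α), (1/α,β/α), (β/α,1/α),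
(1/β,α/β), (α/β,1/β)` are pairwise distinct, and each of them gives a non-trivial point
`[x,y,1]` of the Fermat quintic `x⁵+y⁵+z⁵=0` rational over `ℚ(α)`. -/
theorem six_points_on_fermat_quintic (t : ℚ) (h1 : t ≠ 1) (h2 : t ≠ 2) (α : ℂ)
    (hα : Polynomial.aeval α (f t) = 0)
    (β : ℂ)
    (hβ : β = (a0 t : ℂ) + (a1 t : ℂ) * α + (a2 t : ℂ) * α^2 + (a3 t : ℂ) * α^3
      + (a4 t : ℂ) * α^4 + (a5 t : ℂ) * α^5) :
    List.Pairwise (· ≠ ·)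
      [(α, β), (β, α), (1/α, β/α), (β/α, 1/α), (1/β, α/β), (α/β, 1/β)] ∧
    ∀ p ∈ [(α, β), (β, α), (1/α, β/α), (β/α, 1/α), (1/β, α/β), (α/β, 1/β)],
      p.1^5 + p.2^5 + 1 = 0 ∧ p.1 ≠ 0 ∧ p.2 ≠ 0 ∧ p.1 ∈ ℚ⟮α⟯ ∧ p.2 ∈ ℚ⟮α⟯ := by
  have hq : t^2 + t - 1 ≠ 0 := by
    have := quad_ne t
    contrapose! this
    linear_combination this
  have hq4 : t^4 - 3*t^3 - t^2 + 3*t + 1 ≠ 0 := by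
    have := quart_ne t
    contrapose! this
    linear_combination this
  have hd : t - 2 ≠ 0 := sub_ne_zero.mpr h2
  have hqC : (t:ℂ)^2 + (t:ℂ) - 1 ≠ 0 := by exact_mod_cast hq
  have hq4C : (t:ℂ)^4 - 3*(t:ℂ)^3 - (t:ℂ)^2 + 3*(t:ℂ) + 1 ≠ 0 := by exact_mod_cast hq4
  have hdC : (t:ℂ) - 2 ≠ 0 := by exact_mod_cast hd
  have h1C : (t:ℂ) - 1 ≠ 0 := by exact_mod_cast sub_ne_zero.mpr h1
  have hdisc : 4 + 20*(t:ℂ)^3 + 10*(t:ℂ)^4 - 7*(t:ℂ)^5 ≠ 0 := by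
    have h : 4 + 20*t^3 + 10*t^4 - 7*t^5 ≠ 0 := by
      have := disc_ne t
      contrapose! this
      linear_combination this
    exact_mod_cast h
  have hfa : α^6 + (u t : ℂ) * α^5 + (v t : ℂ) * α^4 + (w t : ℂ) * α^3 + (v t : ℂ) * α^2
      + (u t : ℂ) * α + 1 = 0 := by
    simpa [f] using hα
  have h_u : (u t : ℂ) * (((t:ℂ)^2 + (t:ℂ) - 1)) = (3*(t:ℂ)^2 - 2*(t:ℂ) + 2) := by
    rw [u]
    push_cast
    exact div_mul_cancel₀ _ (hqC)
  have h_v : (v t : ℂ) * (((t:ℂ) - 2) * ((t:ℂ)^2 + (t:ℂ) - 1)^2) = ((t:ℂ)^5 - 5*(t:ℂ)^4 + 10*(t:ℂ)^3 - 20*(t:ℂ)^2 + 15*(t:ℂ) - 7) := by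
    rw [v]
    push_cast
    exact div_mul_cancel₀ _ (mul_ne_zero hdC (pow_ne_zero 2 hqC))
  have h_w : (w t : ℂ) * (((t:ℂ) - 2) * ((t:ℂ)^2 + (t:ℂ) - 1)^2) = (-3*(t:ℂ)^5 + 10*(t:ℂ)^4 - 20*(t:ℂ)^3 + 20*(t:ℂ)^2 - 20*(t:ℂ) + 6) := by
    rw [w]
    push_cast
    exact div_mul_cancel₀ _ (mul_ne_zero hdC (pow_ne_zero 2 hqC))
  have h_a0 : (a0 t : ℂ) * ((((t:ℂ)^4 - 3*(t:ℂ)^3 - (t:ℂ)^2 + 3*(t:ℂ) + 1) * ((t:ℂ) - 2))) = -(((t:ℂ)^2 + 1) * ((t:ℂ)^3 - (t:ℂ)^2 + 2*(t:ℂ) - 3)) := by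
    rw [a0, s]
    push_cast
    exact div_mul_cancel₀ _ (mul_ne_zero hq4C hdC)
  have h_a1 : (a1 t : ℂ) * (((t:ℂ)^2 + (t:ℂ) - 1) * (((t:ℂ)^4 - 3*(t:ℂ)^3 - (t:ℂ)^2 + 3*(t:ℂ) + 1) * ((t:ℂ) - 2))) = -(3*(t:ℂ)^7 - 9*(t:ℂ)^6 + 16*(t:ℂ)^5 - 15*(t:ℂ)^4 + 10*(t:ℂ)^3 - 11*(t:ℂ)^2 + 8*(t:ℂ) - 7) := by
    rw [a1, s]
    push_cast
    exact div_mul_cancel₀ _ (mul_ne_zero hqC (mul_ne_zero hq4C hdC))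
  have h_a2 : (a2 t : ℂ) * (((t:ℂ)^2 + (t:ℂ) - 1) * ((t:ℂ) - 2) * (((t:ℂ)^4 - 3*(t:ℂ)^3 - (t:ℂ)^2 + 3*(t:ℂ) + 1) * ((t:ℂ) - 2))) = (2*(t:ℂ)^8 - 14*(t:ℂ)^7 + 52*(t:ℂ)^6 - 99*(t:ℂ)^5 + 100*(t:ℂ)^4 - 54*(t:ℂ)^3 + 38*(t:ℂ)^2 - 44*(t:ℂ) + 13) := by
    rw [a2, s]
    push_cast
    exact div_mul_cancel₀ _ (mul_ne_zero (mul_ne_zero hqC hdC) (mul_ne_zero hq4C hdC))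
  have h_a3 : (a3 t : ℂ) * (((t:ℂ)^2 + (t:ℂ) - 1) * ((t:ℂ) - 2) * (((t:ℂ)^4 - 3*(t:ℂ)^3 - (t:ℂ)^2 + 3*(t:ℂ) + 1) * ((t:ℂ) - 2))) = ((t:ℂ)^8 + (t:ℂ)^7 - 21*(t:ℂ)^6 + 65*(t:ℂ)^5 - 90*(t:ℂ)^4 + 78*(t:ℂ)^3 - 57*(t:ℂ)^2 + 32*(t:ℂ) - 15) := by
    rw [a3, s]
    push_cast
    exact div_mul_cancel₀ _ (mul_ne_zero (mul_ne_zero hqC hdC) (mul_ne_zero hq4C hdC))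
  have h_a4 : (a4 t : ℂ) * ((((t:ℂ)^4 - 3*(t:ℂ)^3 - (t:ℂ)^2 + 3*(t:ℂ) + 1) * ((t:ℂ) - 2))) = -(2*(t:ℂ)^5 - 6*(t:ℂ)^4 + 13*(t:ℂ)^3 - 14*(t:ℂ)^2 + 7*(t:ℂ) - 5) := by
    rw [a4, s]
    push_cast
    exact div_mul_cancel₀ _ (mul_ne_zero hq4C hdC)
  have h_a5 : (a5 t : ℂ) * ((((t:ℂ)^4 - 3*(t:ℂ)^3 - (t:ℂ)^2 + 3*(t:ℂ) + 1) * ((t:ℂ) - 2))) = -(((t:ℂ)^2 + (t:ℂ) - 1) * ((t:ℂ)^3 - (t:ℂ)^2 + 2*(t:ℂ) - 3)) := by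
    rw [a5, s]
    push_cast
    exact div_mul_cancel₀ _ (mul_ne_zero hq4C hdC)
  have hF : (((t:ℂ)-2)*((t:ℂ)^2+(t:ℂ)-1)^2*(α^6+1) + (3*(t:ℂ)^2-2*(t:ℂ)+2)*(((t:ℂ)-2)*((t:ℂ)^2+(t:ℂ)-1))*(α^5+α) + ((t:ℂ)^5 - 5*(t:ℂ)^4 + 10*(t:ℂ)^3 - 20*(t:ℂ)^2 + 15*(t:ℂ) - 7)*(α^4+α^2) + (-3*(t:ℂ)^5 + 10*(t:ℂ)^4 - 20*(t:ℂ)^3 + 20*(t:ℂ)^2 - 20*(t:ℂ) + 6)*α^3) = 0 := by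
    linear_combination ((t:ℂ) - 2)*((t:ℂ)^2 + (t:ℂ) - 1)^2 * hfa - ((t:ℂ) - 2)*((t:ℂ)^2 + (t:ℂ) - 1)*(α^5+α) * h_u - (α^4+α^2) * h_v - α^3 * h_w
  have hb : (((t:ℂ)^2+(t:ℂ)-1)*((t:ℂ)-2)*(((t:ℂ)^4 - 3*(t:ℂ)^3 - (t:ℂ)^2 + 3*(t:ℂ) + 1)*((t:ℂ)-2))) * β = (-(((t:ℂ)^2 + 1) * ((t:ℂ)^3 - (t:ℂ)^2 + 2*(t:ℂ) - 3))*(((t:ℂ)^2+(t:ℂ)-1)*((t:ℂ)-2))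
      - (3*(t:ℂ)^7 - 9*(t:ℂ)^6 + 16*(t:ℂ)^5 - 15*(t:ℂ)^4 + 10*(t:ℂ)^3 - 11*(t:ℂ)^2 + 8*(t:ℂ) - 7)*((t:ℂ)-2)*α
      + (2*(t:ℂ)^8 - 14*(t:ℂ)^7 + 52*(t:ℂ)^6 - 99*(t:ℂ)^5 + 100*(t:ℂ)^4 - 54*(t:ℂ)^3 + 38*(t:ℂ)^2 - 44*(t:ℂ) + 13)*α^2
      + ((t:ℂ)^8 + (t:ℂ)^7 - 21*(t:ℂ)^6 + 65*(t:ℂ)^5 - 90*(t:ℂ)^4 + 78*(t:ℂ)^3 - 57*(t:ℂ)^2 + 32*(t:ℂ) - 15)*α^3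
      - (2*(t:ℂ)^5 - 6*(t:ℂ)^4 + 13*(t:ℂ)^3 - 14*(t:ℂ)^2 + 7*(t:ℂ) - 5)*(((t:ℂ)^2+(t:ℂ)-1)*((t:ℂ)-2))*α^4
      - (((t:ℂ)^2 + (t:ℂ) - 1) * ((t:ℂ)^3 - (t:ℂ)^2 + 2*(t:ℂ) - 3))*(((t:ℂ)^2+(t:ℂ)-1)*((t:ℂ)-2))*α^5) := by
    rw [hβ]
    linear_combination ((t:ℂ)^2 + (t:ℂ) - 1)*((t:ℂ) - 2) * h_a0 + ((t:ℂ) - 2)*α * h_a1 + α^2 * h_a2 + α^3 * h_a3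
      + ((t:ℂ)^2 + (t:ℂ) - 1)*((t:ℂ) - 2)*α^4 * h_a4 + ((t:ℂ)^2 + (t:ℂ) - 1)*((t:ℂ) - 2)*α^5 * h_a5
  have R1 := rel1 _ _ _ hF hb
  have R2 := rel2 _ _ _ hF hb
  clear hb hF h_u h_v h_w h_a0 h_a1 h_a2 h_a3 h_a4 h_a5
  have hD : (((t:ℂ)^2+(t:ℂ)-1)*((t:ℂ)-2)*(((t:ℂ)^4 - 3*(t:ℂ)^3 - (t:ℂ)^2 + 3*(t:ℂ) + 1)*((t:ℂ)-2))) ≠ 0 :=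
    mul_ne_zero (mul_ne_zero hqC hdC) (mul_ne_zero hq4C hdC)
  generalize (((t:ℂ)^2+(t:ℂ)-1)*((t:ℂ)-2)*(((t:ℂ)^4 - 3*(t:ℂ)^3 - (t:ℂ)^2 + 3*(t:ℂ) + 1)*((t:ℂ)-2))) = D at R1 R2 hD
  have G1 : ((t:ℂ)-2)*(α+β+α*β) + (1+α+β)^2 = 0 := by
    have : D^2 * (((t:ℂ)-2)*(α+β+α*β) + (1+α+β)^2) = 0 := by linear_combination R1
    exact (mul_eq_zero.mp this).resolve_left (pow_ne_zero 2 hD)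
  have G2 : 5*((t:ℂ)-1)*(α*β) - ((t:ℂ)^2+(t:ℂ)-1)*((1+α+β)*(α+β+α*β)) = 0 := by
    have : D^2 * (5*((t:ℂ)-1)*(α*β) - ((t:ℂ)^2+(t:ℂ)-1)*((1+α+β)*(α+β+α*β))) = 0 := by
      linear_combination R2
    exact (mul_eq_zero.mp this).resolve_left (pow_ne_zero 2 hD)
  have ha0 : α ≠ 0 := by
    rintro rfl
    simp at hfa
  have hP : α^5 + β^5 + 1 = 0 := core_fermat _ _ _ h1C G1 G2
  -- `e₁ = 0` or `e₂ = 0` is impossible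
  have he : ∀ {x : ℂ}, x = 1 + α + β → x ≠ 0 := by
    rintro x rfl h
    have h3 : α * β = 0 := by
      have : 5*((t:ℂ)-1)*(α*β) = 0 := by
        rw [h] at G2
        linear_combination G2
      exact (mul_eq_zero.mp this).resolve_left (mul_ne_zero (by norm_num) h1C)
    have h4 : α + β + α*β = 0 := by
      have : ((t:ℂ)-2)*(α+β+α*β) = 0 := by
        rw [h] at G1
        linear_combination G1
      exact (mul_eq_zero.mp this).resolve_left hdC
    have : (1:ℂ) = 0 := by linear_combination h - h4 + h3
    exact one_ne_zero this
  have he1 : 1 + α + β ≠ 0 := he rfl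
  have he2 : α + β + α*β ≠ 0 := by
    intro h
    rw [h] at G1
    exact he1 (pow_eq_zero_iff (two_ne_zero) |>.mp (by linear_combination G1))
  have hb0 : β ≠ 0 := by
    intro h
    have h3 : α * β = 0 := by rw [h, mul_zero]
    rw [h3] at G2
    have : ((t:ℂ)^2+(t:ℂ)-1)*((1+α+β)*(α+β+0)) = 0 := by linear_combination -G2
    rw [h3] at he2
    exact mul_ne_zero hqC (mul_ne_zero he1 he2) this
  have hds : (α-β)*(α-1)*(β-1) ≠ 0 := by
    intro h
    have := core_disc _ _ _ G1 G2
    rw [h] at this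
    exact mul_ne_zero (pow_ne_zero 3 he2) hdisc (by linear_combination this)
  have hab : α - β ≠ 0 := fun h => hds (by rw [h]; ring)
  have ha1 : α - 1 ≠ 0 := fun h => hds (by rw [h]; ring)
  have hb1 : β - 1 ≠ 0 := fun h => hds (by rw [h]; ring)
  have hc1 : ¬ (α^2 = β ∧ α * β = 1) := by
    rintro ⟨h, h'⟩
    have : (α - 1) * (1 + α + β) = 0 := by linear_combination h + h'
    exact mul_ne_zero ha1 he1 this
  have hc2 : ¬ (β^2 = α ∧ α * β = 1) := by
    rintro ⟨h, h'⟩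
    have : (β - 1) * (1 + α + β) = 0 := by linear_combination h + h'
    exact mul_ne_zero hb1 he1 this
  have ham : α ∈ ℚ⟮α⟯ := mem_adjoin_simple_self ℚ α
  have hr : ∀ r : ℚ, (r : ℂ) ∈ ℚ⟮α⟯ := fun r => by
    exact ℚ⟮α⟯.algebraMap_mem r
  have hbm : β ∈ ℚ⟮α⟯ := by
    rw [hβ]
    exact add_mem (add_mem (add_mem (add_mem (add_mem (hr _) (mul_mem (hr _) ham))
      (mul_mem (hr _) (pow_mem ham _))) (mul_mem (hr _) (pow_mem ham _)))
      (mul_mem (hr _) (pow_mem ham _))) (mul_mem (hr _) (pow_mem ham _))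
  have hia : 1/α ∈ ℚ⟮α⟯ := div_mem (one_mem _) ham
  have hib : 1/β ∈ ℚ⟮α⟯ := div_mem (one_mem _) hbm
  have hba : β/α ∈ ℚ⟮α⟯ := div_mem hbm ham
  have hab' : α/β ∈ ℚ⟮α⟯ := div_mem ham hbm
  have hia0 : 1/α ≠ 0 := one_div_ne_zero ha0
  have hib0 : 1/β ≠ 0 := one_div_ne_zero hb0
  have hba0 : β/α ≠ 0 := div_ne_zero hb0 ha0
  have hab0 : α/β ≠ 0 := div_ne_zero ha0 hb0
  have E1 : (1/α)^5 + (β/α)^5 + 1 = 0 := by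
    field_simp
    linear_combination hP
  have E2 : (1/β)^5 + (α/β)^5 + 1 = 0 := by
    field_simp
    linear_combination hP
  clear hβ hα hfa R1 R2 G1 G2 hr
  constructor
  · simp only [List.pairwise_cons, List.mem_cons, List.not_mem_nil, or_false, forall_eq_or_imp,
      forall_eq, ne_eq, Prod.mk.injEq, List.Pairwise.nil, and_true, IsEmpty.forall_iff,
      implies_true]
    refine ⟨⟨?_, ?_, ?_, ?_, ?_⟩, ⟨?_, ?_, ?_, ?_⟩, ⟨?_, ?_, ?_⟩, ⟨?_, ?_⟩, ?_⟩ <;>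
      rintro ⟨p, r⟩ <;> (try field_simp at p) <;> (try field_simp at r) <;> grind
  · intro p hp
    simp only [List.mem_cons, List.not_mem_nil, or_false] at hp
    rcases hp with rfl | rfl | rfl | rfl | rfl | rfl
    · exact ⟨hP, ha0, hb0, ham, hbm⟩
    · exact ⟨by linear_combination hP, hb0, ha0, hbm, ham⟩
    · exact ⟨E1, hia0, hba0, hia, hba⟩
    · exact ⟨by linear_combination E1, hba0, hia0, hba, hia⟩
    · exact ⟨E2, hib0, hab0, hib, hab'⟩
    · exact ⟨by linear_combination E2, hab0, hib0, hab', hib⟩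
end

section
/- Let t be a rational number with t ≠ 2, let x ∈ ℂ satisfy f_t(x) = 0, and set y = a₀ + a₁x + a₂x² + a₃x³ + a₄x⁴ + a₅x⁵. Then f_t(y) = 0, x⁵ + y⁵ + 1 = 0, and x² + y² + 1 + t(xy + x + y) = 0; that is, the point [x,y,1] lies on the intersection of the Fermat quintic x⁵+y⁵+z⁵=0 with the conic C_t : x²+y²+z²+t(xy+xz+yz)=0. -/
open Polynomial IntermediateField

namespace PointAux

/-- Leading coefficient clearing the denominators of `f t`. -/
def cL (t : ℂ) : ℂ := (t - 2) * (t^2 + t - 1)^2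

/-- Common denominator of the `aᵢ`. -/
def cD (t : ℂ) : ℂ := (t^2 + t - 1) * (t - 2)^2 * (t^4 - 3*t^3 - t^2 + 3*t + 1)

/-- `cL t * f t`, evaluated at `x`. -/
def pF (t x : ℂ) : ℂ :=
  cL t * (x^6 + 1) + (3*t^2 - 2*t + 2) * (t^2 + t - 1) * (t - 2) * (x^5 + x)
    + (t^5 - 5*t^4 + 10*t^3 - 20*t^2 + 15*t - 7) * (x^4 + x^2)
    + (-3*t^5 + 10*t^4 - 20*t^3 + 20*t^2 - 20*t + 6) * x^3

/-- Numerator of `y` over the denominator `cD t`. -/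
def pN (t x : ℂ) : ℂ :=
  -((t^2 + 1) * (t^3 - t^2 + 2*t - 3)) * (t^2 + t - 1) * (t - 2)
    - (3*t^7 - 9*t^6 + 16*t^5 - 15*t^4 + 10*t^3 - 11*t^2 + 8*t - 7) * (t - 2) * x
    + (2*t^8 - 14*t^7 + 52*t^6 - 99*t^5 + 100*t^4 - 54*t^3 + 38*t^2 - 44*t + 13) * x^2
    + (t^8 + t^7 - 21*t^6 + 65*t^5 - 90*t^4 + 78*t^3 - 57*t^2 + 32*t - 15) * x^3
    - (2*t^5 - 6*t^4 + 13*t^3 - 14*t^2 + 7*t - 5) * (t^2 + t - 1) * (t - 2) * x^4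
    - (t^2 + t - 1)^2 * (t - 2) * (t^3 - t^2 + 2*t - 3) * x^5

/-- Auxiliary polynomial. -/
def q1 (t x : ℂ) : ℂ :=
  ((-t^12 + 10*t^11 - 41*t^10 + 111*t^9 - 203*t^8 + 163*t^7 + 68*t^6 - 120*t^5 - 127*t^4 + 196*t^3 - 42*t^2 + 9*t - 26)
      + (11*t^10 - 84*t^9 + 262*t^8 - 446*t^7 + 488*t^6 - 378*t^5 + 163*t^4 - 9*t^3 + 72*t^2 - 116*t + 32)*x
      + (-2*t^11 + 7*t^10 + 6*t^9 - 93*t^8 + 264*t^7 - 439*t^6 + 523*t^5 - 442*t^4 + 251*t^3 - 98*t^2 + 46*t - 29)*x^2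
      + (t^11 - 9*t^10 + 30*t^9 - 45*t^8 + 25*t^7 + 36*t^6 - 169*t^5 + 315*t^4 - 285*t^3 + 150*t^2 - 76*t + 24)*x^3
      + (t^11 - 2*t^10 - 10*t^7 + 26*t^6 - 12*t^5 + 25*t^3 - 80*t^2 + 69*t - 18)*x^4)

/-- Auxiliary polynomial. -/
def q2 (t x : ℂ) : ℂ :=
  ((-t^7 + 3*t^6 - 9*t^5 + 16*t^4 - 3*t^3 - 9*t^2 + 2*t - 1)
      + (-3*t^7 + 9*t^6 - 22*t^5 + 36*t^4 - 8*t^3 - 20*t^2 + 5)*x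
      + (-3*t^7 + 7*t^6 - 10*t^5 + 11*t^4 + 12*t^3 - 25*t^2 + 4*t + 1)*x^2
      + (-t^7 + t^6 + t^5 + 5*t^3 - 8*t^2 - 2*t + 3)*x^3)

/-- Auxiliary polynomial. -/
def q3 (t x : ℂ) : ℂ :=
  ((t^13 - 6*t^12 + 18*t^11 - 40*t^10 + 44*t^9 + 17*t^8 - 51*t^7 - 2*t^6 - 12*t^5 + 37*t^4 + 12*t^3 - 9*t^2 - 3*t - 6)
      + (4*t^13 - 22*t^12 + 56*t^11 - 100*t^10 + 63*t^9 + 156*t^8 - 200*t^7 - 107*t^6 + 129*t^5 + 74*t^4 - 13*t^3 - 32*t^2 - 10*t + 2)*x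
      + (6*t^13 - 27*t^12 + 42*t^11 - 19*t^10 - 114*t^9 + 328*t^8 - 127*t^7 - 369*t^6 + 191*t^5 + 193*t^4 - 30*t^3 - 78*t^2 + 4)*x^2
      + (4*t^13 - 12*t^12 - 4*t^11 + 42*t^10 - 66*t^9 + 56*t^8 + 129*t^7 - 300*t^6 + 25*t^5 + 222*t^4 - 63*t^3 - 30*t^2 - 14*t + 12)*x^3
      + (t^13 - t^12 - 7*t^11 + 6*t^10 + 10*t^9 - 3*t^8 + 23*t^7 - 45*t^6 - 57*t^5 + 100*t^4 + 12*t^3 - 57*t^2 + 18*t)*x^4)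

/-- Auxiliary polynomial. -/
def A3 (t x : ℂ) : ℂ :=
  ((t)
      + (t^2 + t)*x
      + (t^2 + t)*x^2
      + (t)*x^3)

/-- Auxiliary polynomial. -/
def B3 (t x : ℂ) : ℂ :=
  ((t^2 - 1)
      + (2*t^2 - t)*x
      + (t^2 - 1)*x^2)

/-- Auxiliary polynomial. -/
def A4 (t x : ℂ) : ℂ :=
  ((-t^2 + 1)
      + (-t^3 - 2*t^2 + 2*t)*x
      + (-2*t^3 - t^2 + 2)*x^2
      + (-t^3 - 2*t^2 + 2*t)*x^3
      + (-t^2 + 1)*x^4)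

/-- Auxiliary polynomial. -/
def B4 (t x : ℂ) : ℂ :=
  ((-t^3 + 2*t)
      + (-3*t^3 + 2*t^2 + 2*t)*x
      + (-3*t^3 + 2*t^2 + 2*t)*x^2
      + (-t^3 + 2*t)*x^3)

/-- Auxiliary polynomial. -/
def A5 (t x : ℂ) : ℂ :=
  ((t^3 - 2*t)
      + (t^4 + 3*t^3 - 4*t^2 - 2*t)*x
      + (3*t^4 + 2*t^3 - 4*t^2 - 4*t)*x^2
      + (3*t^4 + 2*t^3 - 4*t^2 - 4*t)*x^3
      + (t^4 + 3*t^3 - 4*t^2 - 2*t)*x^4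
      + (t^3 - 2*t)*x^5)

/-- Auxiliary polynomial. -/
def B5 (t x : ℂ) : ℂ :=
  ((t^4 - 3*t^2 + 1)
      + (4*t^4 - 3*t^3 - 6*t^2 + 2*t)*x
      + (6*t^4 - 6*t^3 - 5*t^2 + 2)*x^2
      + (4*t^4 - 3*t^3 - 6*t^2 + 2*t)*x^3
      + (t^4 - 3*t^2 + 1)*x^4)

/-- Auxiliary polynomial. -/
def A6 (t x : ℂ) : ℂ :=
  ((-t^4 + 3*t^2 - 1)
      + (-t^5 - 4*t^4 + 6*t^3 + 6*t^2 - 3*t)*x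
      + (-4*t^5 - 4*t^4 + 12*t^3 + 6*t^2 - 3)*x^2
      + (-6*t^5 - 2*t^4 + 11*t^3 + 12*t^2 - 6*t)*x^3
      + (-4*t^5 - 4*t^4 + 12*t^3 + 6*t^2 - 3)*x^4
      + (-t^5 - 4*t^4 + 6*t^3 + 6*t^2 - 3*t)*x^5
      + (-t^4 + 3*t^2 - 1)*x^6)

/-- Auxiliary polynomial. -/
def B6 (t x : ℂ) : ℂ :=
  ((-t^5 + 4*t^3 - 3*t)
      + (-5*t^5 + 4*t^4 + 12*t^3 - 6*t^2 - 3*t)*x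
      + (-10*t^5 + 12*t^4 + 13*t^3 - 6*t^2 - 6*t)*x^2
      + (-10*t^5 + 12*t^4 + 13*t^3 - 6*t^2 - 6*t)*x^3
      + (-5*t^5 + 4*t^4 + 12*t^3 - 6*t^2 - 3*t)*x^4
      + (-t^5 + 4*t^3 - 3*t)*x^5)

theorem id1 (t x : ℂ) : pN t x ^ 2 + t * (x + 1) * cD t * pN t x
    + cD t ^ 2 * (x^2 + t * x + 1) = q1 t x * pF t x := by
  simp only [pN, cD, pF, cL, q1]
  ring

theorem id2 (t x : ℂ) : cD t * (x^5 + 1 + A5 t x) + B5 t x * pN t x = q2 t x * pF t x := by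
  simp only [pN, cD, pF, cL, q2, A5, B5]
  ring

/-- Constant part of `pF t y` modulo the conic. -/
def AF (t x : ℂ) : ℂ :=
  cL t * (A6 t x + 1) + (3*t^2 - 2*t + 2) * (t^2 + t - 1) * (t - 2) * A5 t x
    + (t^5 - 5*t^4 + 10*t^3 - 20*t^2 + 15*t - 7) * (A4 t x - (x^2 + t * x + 1))
    + (-3*t^5 + 10*t^4 - 20*t^3 + 20*t^2 - 20*t + 6) * A3 t x

/-- Linear part of `pF t y` modulo the conic. -/
def BF (t x : ℂ) : ℂ :=
  cL t * B6 t x + (3*t^2 - 2*t + 2) * (t^2 + t - 1) * (t - 2) * (B5 t x + 1)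
    + (t^5 - 5*t^4 + 10*t^3 - 20*t^2 + 15*t - 7) * (B4 t x - t * (x + 1))
    + (-3*t^5 + 10*t^4 - 20*t^3 + 20*t^2 - 20*t + 6) * B3 t x

theorem id3 (t x : ℂ) : cD t * AF t x + BF t x * pN t x = q3 t x * pF t x := by
  simp only [pN, cD, pF, cL, q3, AF, BF, A3, B3, A4, B4, A5, B5, A6, B6]
  ring

theorem main (t x y : ℂ) (hD : cD t ≠ 0) (hF : pF t x = 0) (hy : cD t * y = pN t x) :
    pF t y = 0 ∧ x^5 + y^5 + 1 = 0 ∧ x^2 + y^2 + 1 + t * (x*y + x + y) = 0 := by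
  have i1 := id1 t x
  have i2 := id2 t x
  have i3 := id3 t x
  rw [hF, mul_zero, ← hy] at i1 i2 i3
  have hc : x^2 + y^2 + 1 + t * (x*y + x + y) = 0 := by
    have : cD t ^ 2 * (x^2 + y^2 + 1 + t * (x*y + x + y)) = 0 := by
      linear_combination i1
    exact (mul_eq_zero.mp this).resolve_left (pow_ne_zero 2 hD)
  have y2 : y^2 = -(x^2 + t * x + 1) - t * (x + 1) * y := by linear_combination hc
  have y3 : y^3 = A3 t x + B3 t x * y := by
    simp only [A3, B3]
    linear_combination (y - t * (x + 1)) * y2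
  have y4 : y^4 = A4 t x + B4 t x * y := by
    have : y^4 = A3 t x * y + B3 t x * y^2 := by linear_combination y * y3
    rw [this, y2]
    simp only [A3, B3, A4, B4]
    ring
  have y5 : y^5 = A5 t x + B5 t x * y := by
    have : y^5 = A4 t x * y + B4 t x * y^2 := by linear_combination y * y4
    rw [this, y2]
    simp only [A5, B5, A4, B4]
    ring
  have y6 : y^6 = A6 t x + B6 t x * y := by
    have : y^6 = A5 t x * y + B5 t x * y^2 := by linear_combination y * y5
    rw [this, y2]
    simp only [A5, B5, A6, B6]
    ring
  refine ⟨?_, ?_, hc⟩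
  · refine (mul_eq_zero.mp (?_ : cD t * pF t y = 0)).resolve_left hD
    have : pF t y = AF t x + BF t x * y := by
      unfold pF AF BF
      rw [y6, y5, y4, y3, y2]
      ring
    rw [this]
    linear_combination i3
  · refine (mul_eq_zero.mp (?_ : cD t * (x^5 + y^5 + 1) = 0)).resolve_left hD
    rw [y5]
    linear_combination i2

/-- `t² + t - 1` has no rational root (parity of numerator and denominator). -/
theorem quad_ne (t : ℚ) : t^2 + t - 1 ≠ 0 := by
  intro h
  have hd : (t.den : ℚ) ≠ 0 := by exact_mod_cast t.den_nz
  have ht : t * t.den = t.num := Rat.mul_den_eq_num t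
  have e : (t.num : ℚ)^2 + t.num * t.den - (t.den : ℚ)^2 = 0 := by
    rw [← ht]; linear_combination (t.den : ℚ)^2 * h
  have e' : t.num^2 + t.num * (t.den : ℤ) - (t.den : ℤ)^2 = 0 := by exact_mod_cast e
  have cop := t.reduced
  have par := congrArg (fun z : ℤ => (z : ZMod 2)) e'
  push_cast at par
  have key : ∀ a b : ZMod 2, a^2 + a*b - b^2 = 0 → a = 0 ∧ b = 0 := by decide
  obtain ⟨ha, hb⟩ := key _ _ par
  have h1 : 2 ∣ t.num.natAbs := Int.natCast_dvd.mp ((ZMod.intCast_zmod_eq_zero_iff_dvd _ 2).mp ha)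
  have h2 : 2 ∣ t.den := (ZMod.natCast_eq_zero_iff _ 2).mp hb
  have := Nat.dvd_gcd h1 h2
  rw [cop] at this
  omega

/-- The quartic factor of `s t` has no rational root. -/
theorem quart_ne (t : ℚ) : t^4 - 3*t^3 - t^2 + 3*t + 1 ≠ 0 := by
  intro h
  have ht : t * t.den = t.num := Rat.mul_den_eq_num t
  have e : (t.num : ℚ)^4 - 3 * t.num^3 * t.den - t.num^2 * t.den^2 + 3 * t.num * t.den^3
      + (t.den : ℚ)^4 = 0 := by
    rw [← ht]; linear_combination (t.den : ℚ)^4 * h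
  have e' : t.num^4 - 3 * t.num^3 * (t.den : ℤ) - t.num^2 * (t.den : ℤ)^2
      + 3 * t.num * (t.den : ℤ)^3 + (t.den : ℤ)^4 = 0 := by exact_mod_cast e
  have cop := t.reduced
  have par := congrArg (fun z : ℤ => (z : ZMod 2)) e'
  push_cast at par
  have key : ∀ a b : ZMod 2, a^4 - 3*a^3*b - a^2*b^2 + 3*a*b^3 + b^4 = 0 → a = 0 ∧ b = 0 := by
    decide
  obtain ⟨ha, hb⟩ := key _ _ par
  have h1 : 2 ∣ t.num.natAbs := Int.natCast_dvd.mp ((ZMod.intCast_zmod_eq_zero_iff_dvd _ 2).mp ha)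
  have h2 : 2 ∣ t.den := (ZMod.natCast_eq_zero_iff _ 2).mp hb
  have := Nat.dvd_gcd h1 h2
  rw [cop] at this
  omega

theorem aeval_f (t : ℚ) (h2 : (t : ℂ) - 2 ≠ 0) (hE : (t : ℂ)^2 + t - 1 ≠ 0) (x : ℂ) :
    cL t * Polynomial.aeval x (f t) = pF t x := by
  simp only [f, u, v, w, map_add, map_mul, map_pow, aeval_X, aeval_C, map_one,
    eq_ratCast]
  unfold pF cL
  push_cast
  generalize (t : ℂ)^2 + t - 1 = e at hE ⊢
  generalize (t : ℂ) - 2 = d at h2 ⊢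
  field_simp
  ring

end PointAux

/-- If `t ≠ 2` is rational, `x ∈ ℂ` is a root of `f t` and
`y = a₀ + a₁x + a₂x² + a₃x³ + a₄x⁴ + a₅x⁵`, then `f t (y) = 0`, `x⁵ + y⁵ + 1 = 0` and
`x² + y² + 1 + t(xy + x + y) = 0`; i.e. `[x,y,1]` lies on the intersection of the Fermat
quintic with the conic `C_t`. -/
theorem point_on_intersection (t : ℚ) (h2 : t ≠ 2) (x : ℂ)
    (hx : Polynomial.aeval x (f t) = 0)
    (y : ℂ)
    (hy : y = (a0 t : ℂ) + (a1 t : ℂ) * x + (a2 t : ℂ) * x^2 + (a3 t : ℂ) * x^3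
      + (a4 t : ℂ) * x^4 + (a5 t : ℂ) * x^5) :
    Polynomial.aeval y (f t) = 0 ∧ x^5 + y^5 + 1 = 0 ∧
      x^2 + y^2 + 1 + (t : ℂ) * (x*y + x + y) = 0 := by
  have h2Q : t - 2 ≠ 0 := sub_ne_zero.mpr h2
  have hT : (t : ℂ) - 2 ≠ 0 := by exact_mod_cast h2Q
  have hE : (t : ℂ)^2 + t - 1 ≠ 0 := by exact_mod_cast PointAux.quad_ne t
  have hQ : (t : ℂ)^4 - 3*(t : ℂ)^3 - (t : ℂ)^2 + 3*t + 1 ≠ 0 := by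
    exact_mod_cast PointAux.quart_ne t
  have hL : PointAux.cL t ≠ 0 := mul_ne_zero hT (pow_ne_zero 2 hE)
  have hD : PointAux.cD t ≠ 0 := mul_ne_zero (mul_ne_zero hE (pow_ne_zero 2 hT)) hQ
  have hF : PointAux.pF t x = 0 := by rw [← PointAux.aeval_f t hT hE, hx, mul_zero]
  have hN : PointAux.cD t * y = PointAux.pN t x := by
    rw [hy]
    simp only [a0, a1, a2, a3, a4, a5, s]
    unfold PointAux.cD PointAux.pN
    push_cast
    generalize (t : ℂ)^4 - 3*(t : ℂ)^3 - (t : ℂ)^2 + 3*t + 1 = q at hQ ⊢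
    generalize (t : ℂ)^2 + t - 1 = e at hE ⊢
    generalize (t : ℂ) - 2 = d at hT ⊢
    field_simp
    ring
  obtain ⟨m1, m2, m3⟩ := PointAux.main t x y hD hF hN
  refine ⟨?_, m2, m3⟩
  rw [← PointAux.aeval_f t hT hE] at m1
  exact (mul_eq_zero.mp m1).resolve_left hL
end

section
/- Let t be a rational number with t ≠ 1 and t ≠ 2, and let r be the unique real root of 7x⁵ − 10x⁴ − 20x³ − 4. Then the following are equivalent: (i) all six complex roots of f_t are real (equivalently, the splitting field K_t of f_t is totally real); (ii) (2−t)(7t⁵ − 10t⁴ − 20t³ − 4) > 0; (iii) 2 < t < r. -/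
open Polynomial

/-- A complex root of `z² - ηz + 1` with `η` real, `η² ≥ 4`, is real. -/
theorem real_of_quad (η : ℝ) (hη : 4 ≤ η^2) (z : ℂ) (h : z^2 - η*z + 1 = 0) : z.im = 0 := by
  have hre := congrArg Complex.re h
  have him := congrArg Complex.im h
  simp [pow_two] at hre him
  by_contra hb
  have h1 : η = 2*z.re := by
    apply mul_right_cancel₀ hb
    linarith
  subst h1
  have : 0 < z.im^2 := by positivity
  nlinarith

/-- A complex root of a real quadratic with nonnegative discriminant is real. -/
theorem real_of_quad2 (p q : ℝ) (hη : 0 ≤ p^2 - 4*q) (z : ℂ) (h : z^2 + p*z + q = 0) :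
    z.im = 0 := by
  have hre := congrArg Complex.re h
  have him := congrArg Complex.im h
  simp [pow_two] at hre him
  by_contra hb
  have h1 : p = -2*z.re := by
    apply mul_right_cancel₀ hb
    linarith
  subst h1
  have : 0 < z.im^2 := by positivity
  nlinarith

/-- Core of (ii) ⇒ (i), for monic data. -/
theorem core_real (b v w : ℝ) (hb : 2 ≤ b) (h2 : 8 + 4*b + 2*(v-3) + (w-2*b) < 0)
    (hm2 : -8 + 4*b - 2*(v-3) + (w-2*b) < 0)
    (hd : 0 ≤ 18*b*(v-3)*(w-2*b) - 4*b^3*(w-2*b) + b^2*(v-3)^2 - 4*(v-3)^3 - 27*(w-2*b)^2)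
    (z : ℂ) (hz : z^6 + b*z^5 + v*z^4 + w*z^3 + v*z^2 + b*z + 1 = 0) : z.im = 0 := by
  obtain ⟨y, hy2, hy⟩ : ∃ y : ℝ, 2 < y ∧ y^3 + b*y^2 + (v-3)*y + (w-2*b) = 0 := by
    set N : ℝ := 3 + |v-3| + |w-2*b| with hN
    have hc : ContinuousOn (fun y : ℝ => y^3 + b*y^2 + (v-3)*y + (w-2*b)) (Set.Icc 2 N) := by
      fun_prop
    have a1 := abs_nonneg (v-3)
    have a2 := abs_nonneg (w-2*b)
    have a3 := neg_abs_le (v-3)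
    have a4 := neg_abs_le (w-2*b)
    have hN2 : 2 ≤ N := by linarith
    have hpos : 0 ≤ N^3 + b*N^2 + (v-3)*N + (w-2*b) := by
      have e1 : 0 ≤ (N + (v-3)) * N := by
        apply mul_nonneg <;> linarith
      have e2 : 0 ≤ N + (w-2*b) := by linarith
      have e3 : 0 ≤ b*N^2 := by positivity
      have e4 : N^2 + N ≤ N^3 := by nlinarith [mul_nonneg (by linarith : 0 ≤ N) (by nlinarith : 0 ≤ N^2-N-1)]
      nlinarith
    obtain ⟨y, ⟨hy1, hy2⟩, hy3⟩ := intermediate_value_Icc hN2 hc (show (0:ℝ) ∈ _ from ⟨by norm_num; linarith, hpos⟩)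
    refine ⟨y, lt_of_le_of_ne hy1 ?_, hy3⟩
    rintro rfl
    simp only at hy3
    linarith
  obtain ⟨p, hp⟩ : ∃ p, p = b + y := ⟨_, rfl⟩
  obtain ⟨q, hq⟩ : ∃ q, q = (v-3) + p*y := ⟨_, rfl⟩
  have eb : b = p - y := by linarith
  have ev : v = q - p*y + 3 := by linarith
  have ew : w = -q*y + 2*b := by
    rw [hq, hp]; linarith
  rw [ew] at hd hm2
  rw [ev] at hd hm2
  rw [eb] at hd hm2
  have hp4 : 4 < p := by linarith
  have hq4 : 2*p - 4 < q := by
    have : 0 < (2 + y) * (4 - 2*p + q) := by nlinarith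
    have := pos_of_mul_pos_right this (by linarith)
    linarith
  have hdd : 0 ≤ p^2 - 4*q := by
    have hs : 0 < (y^2 + p*y + q)^2 := by
      have : 0 < y^2 + p*y + q := by nlinarith [mul_pos (by linarith : 0 < p) (by linarith : 0 < y)]
      positivity
    have : 0 ≤ (p^2 - 4*q) * (y^2 + p*y + q)^2 := by
      refine hd.trans_eq ?_
      ring
    exact nonneg_of_mul_nonneg_left this hs
  have hz0 : z ≠ 0 := by
    rintro rfl
    norm_num at hz
  have key : (z + z⁻¹ - y) * ((z + z⁻¹)^2 + p*(z + z⁻¹) + q) = 0 := by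
    rw [ew, ev, eb] at hz
    push_cast at hz
    have : z^3 * ((z + z⁻¹ - y) * ((z + z⁻¹)^2 + p*(z + z⁻¹) + q)) = 0 := by
      rw [← hz]
      field_simp
      ring
    exact (mul_eq_zero.mp this).resolve_left (pow_ne_zero _ hz0)
  rcases mul_eq_zero.mp key with h | h
  · refine real_of_quad y (by nlinarith) z ?_
    have e : (y:ℂ) = z + z⁻¹ := by linear_combination -h
    rw [e]
    field_simp
    ring
  · have him := real_of_quad2 p q hdd _ h
    have e : (((z + z⁻¹).re : ℝ) : ℂ) = z + z⁻¹ := by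
      apply Complex.ext <;> simp
      simpa using him.symm
    set η := (z + z⁻¹).re
    rw [← e] at h
    have h' : η^2 + p*η + q = 0 := by exact_mod_cast h
    have hη : η ≤ -2 := by
      by_contra hc
      push Not at hc
      nlinarith [mul_pos (by linarith : 0 < η + 2) (by linarith : 0 < η - 2 + p)]
    refine real_of_quad η (by nlinarith) z ?_
    rw [e]
    field_simp
    ring

/-- Core of (i) ⇒ (ii): a sign change of the trace cubic on `(-2,2)` gives a nonreal root. -/
theorem core_nonreal (b v w : ℝ) (h2 : 0 < 8 + 4*b + 2*(v-3) + (w-2*b))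
    (hm2 : -8 + 4*b - 2*(v-3) + (w-2*b) < 0) :
    ∃ z : ℂ, z^6 + b*z^5 + v*z^4 + w*z^3 + v*z^2 + b*z + 1 = 0 ∧ z.im ≠ 0 := by
  have hc : ContinuousOn (fun y : ℝ => y^3 + b*y^2 + (v-3)*y + (w-2*b)) (Set.Icc (-2) 2) := by
    fun_prop
  obtain ⟨y, ⟨hy1, hy2⟩, hy⟩ := intermediate_value_Ioo (by norm_num) hc
    (show (0:ℝ) ∈ _ from ⟨by norm_num; linarith, by norm_num; linarith⟩)
  simp only at hy
  have hs : 0 < 1 - y^2/4 := by nlinarith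
  have hq := Real.sq_sqrt hs.le
  have hsp := Real.sqrt_pos.mpr hs
  set s := Real.sqrt (1 - y^2/4)
  refine ⟨⟨y/2, s⟩, ?_, hsp.ne'⟩
  have hz : (⟨y/2, s⟩ : ℂ)^2 - y * ⟨y/2, s⟩ + 1 = 0 := by
    apply Complex.ext
    · simp [pow_two]; nlinarith
    · simp [pow_two]; ring
  generalize (⟨y/2, s⟩ : ℂ) = z at hz
  have hyc : (y:ℂ)^3 + b*y^2 + (v-3)*y + (w-2*b) = 0 := by exact_mod_cast hy
  have e : z^2 + 1 = y * z := by linear_combination hz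
  have h3 : z^6 + b*z^5 + v*z^4 + w*z^3 + v*z^2 + b*z + 1
      = (z^2+1)^3 + b*z*(z^2+1)^2 + (v-3)*z^2*(z^2+1) + (w-2*b)*z^3 := by ring
  rw [h3, e]
  linear_combination z^3 * hyc

theorem no_rat_root (t : ℚ) : 7*t^5 - 10*t^4 - 20*t^3 - 4 ≠ 0 := by
  intro h
  have hd : (t.den : ℚ) ≠ 0 := by exact_mod_cast t.den_nz
  have hz : 7*t.num^5 = 10*t.num^4*t.den + 20*t.num^3*t.den^2 + 4*(t.den:ℤ)^5 := by
    have ht := Rat.num_div_den t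
    have : (7*t.num^5 : ℚ) = 10*t.num^4*t.den + 20*t.num^3*t.den^2 + 4*(t.den:ℚ)^5 := by
      have hn : (t.num : ℚ) = t * t.den := by
        field_simp at ht
        linear_combination ht
      rw [hn]
      linear_combination (t.den : ℚ)^5 * h
    exact_mod_cast this
  have hp2 : Prime (2:ℤ) := Int.prime_two
  have hn : (2:ℤ) ∣ t.num := by
    have : (2:ℤ) ∣ 7*t.num^5 := ⟨5*t.num^4*t.den + 10*t.num^3*t.den^2 + 2*(t.den:ℤ)^5, by rw [hz]; ring⟩
    rcases hp2.dvd_or_dvd this with h | h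
    · norm_num at h
    · exact hp2.dvd_of_dvd_pow h
  obtain ⟨k, hk⟩ := hn
  have hde : (2:ℤ) ∣ t.den := by
    rw [hk] at hz
    refine hp2.dvd_of_dvd_pow (n := 5) ⟨28*k^5 - 20*k^4*t.den - 20*k^3*t.den^2, ?_⟩
    linarith
  have hco := t.reduced
  have h1 : 2 ∣ t.num.natAbs := Int.natCast_dvd.mp (by exact_mod_cast Dvd.intro k hk.symm)
  have h2 : 2 ∣ t.den := by exact_mod_cast hde
  have := Nat.dvd_gcd h1 h2
  rw [hco] at this
  norm_num at this

theorem den_ne (t : ℚ) : t^2 + t - 1 ≠ 0 := by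
  intro h
  have h5 : (2*t+1)^2 = 5 := by linear_combination 4*h
  have hs : IsSquare (5:ℚ) := ⟨2*t+1, by rw [← h5]; ring⟩
  have : IsSquare (5:ℕ) := by
    rw [← Rat.isSquare_natCast_iff]; exact_mod_cast hs
  obtain ⟨n, hn⟩ := this
  have : n < 3 := by nlinarith
  interval_cases n <;> omega

theorem aeval_f (t : ℚ) (z : ℂ) : aeval z (f t) =
    z^6 + ((u t : ℝ):ℂ)*z^5 + ((v t : ℝ):ℂ)*z^4 + ((w t : ℝ):ℂ)*z^3 + ((v t : ℝ):ℂ)*z^2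
      + ((u t : ℝ):ℂ)*z + 1 := by
  simp [f]

theorem g_two (t : ℚ) (h2 : t ≠ 2) : 8 + 4*u t + 2*(v t-3) + (w t-2*u t)
    = (7*t^5 - 10*t^4 - 20*t^3 - 4) / ((t-2)*(t^2+t-1)^2) := by
  have h := den_ne t
  have h' : t - 2 ≠ 0 := sub_ne_zero.mpr h2
  unfold u v w
  generalize hD : t^2 + t - 1 = D at *
  field_simp
  rw [← hD]
  ring

theorem g_neg_two (t : ℚ) (h2 : t ≠ 2) : -8 + 4*u t - 2*(v t-3) + (w t-2*u t)
    = -(t-2)^4 / (t^2+t-1)^2 := by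
  have h := den_ne t
  have h' : t - 2 ≠ 0 := sub_ne_zero.mpr h2
  unfold u v w
  generalize hD : t^2 + t - 1 = D at *
  field_simp
  rw [← hD]
  ring

theorem g_disc (t : ℚ) (h2 : t ≠ 2) :
    18*u t*(v t-3)*(w t-2*u t) - 4*u t^3*(w t-2*u t) + u t^2*(v t-3)^2 - 4*(v t-3)^3
      - 27*(w t-2*u t)^2
    = 25 * ((2-t) * (7*t^5 - 10*t^4 - 20*t^3 - 4)) * (t-1)^2 * (t^4-3*t^3-t^2+3*t+1)^2
      / ((t-2)^4*(t^2+t-1)^6) := by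
  have h := den_ne t
  have h' : t - 2 ≠ 0 := sub_ne_zero.mpr h2
  unfold u v w
  generalize hD : t^2 + t - 1 = D at *
  field_simp
  rw [← hD]
  ring

theorem part_two (t : ℝ) (h2 : t ≠ 2) (r : ℝ) (hr : 7*r^5 - 10*r^4 - 20*r^3 - 4 = 0)
    (hr' : ∀ x : ℝ, 7*x^5 - 10*x^4 - 20*x^3 - 4 = 0 → x = r) :
    (2 - t) * (7*t^5 - 10*t^4 - 20*t^3 - 4) > 0 ↔ (2 < t ∧ t < r) := by
  have hc (a b : ℝ) : ContinuousOn (fun x : ℝ => 7*x^5 - 10*x^4 - 20*x^3 - 4) (Set.Icc a b) := by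
    fun_prop
  have up (a b : ℝ) (hab : a ≤ b) (ha : 7*a^5 - 10*a^4 - 20*a^3 - 4 ≤ 0)
      (hb : 0 ≤ 7*b^5 - 10*b^4 - 20*b^3 - 4) : a ≤ r ∧ r ≤ b := by
    obtain ⟨y, hy, hy0⟩ := intermediate_value_Icc hab (hc a b) (show (0:ℝ) ∈ _ from ⟨ha, hb⟩)
    rw [← hr' y hy0]; exact hy
  have dn (a b : ℝ) (hab : a ≤ b) (ha : 0 ≤ 7*a^5 - 10*a^4 - 20*a^3 - 4)
      (hb : 7*b^5 - 10*b^4 - 20*b^3 - 4 ≤ 0) : a ≤ r ∧ r ≤ b := by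
    obtain ⟨y, hy, hy0⟩ := intermediate_value_Icc' hab (hc a b) (show (0:ℝ) ∈ _ from ⟨hb, ha⟩)
    rw [← hr' y hy0]; exact hy
  obtain ⟨r2, r3⟩ := up 2 3 (by norm_num) (by norm_num) (by norm_num)
  have r2' : 2 < r := lt_of_le_of_ne r2 (by rintro rfl; norm_num at hr)
  constructor
  · intro h
    rcases lt_or_gt_of_ne h2 with ht | ht
    · exfalso
      have hq := pos_of_mul_pos_right h (by linarith)
      have := dn t 2 ht.le hq.le (by norm_num)
      linarith
    · refine ⟨ht, ?_⟩
      have hq : 7*t^5 - 10*t^4 - 20*t^3 - 4 < 0 := by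
        by_contra hq
        push Not at hq
        nlinarith
      have ht3 : t < 3 := by
        by_contra hq3
        push Not at hq3
        have e1 : 0 ≤ 7*t^2 - 10*t - 20 - 13 := by nlinarith
        have e2 : 27 ≤ t^3 := by nlinarith [sq_nonneg (t-3)]
        nlinarith [mul_nonneg (by linarith : 0 ≤ t^3) e1]
      refine lt_of_le_of_ne (up t 3 ht3.le hq.le (by norm_num)).1 ?_
      rintro rfl
      linarith
  · rintro ⟨ht, htr⟩
    have hq : 7*t^5 - 10*t^4 - 20*t^3 - 4 < 0 := by
      by_contra hq
      push Not at hq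
      have := up 2 t ht.le (by norm_num) hq
      linarith
    nlinarith

/-- Let `t ≠ 1, 2` be rational and let `r` be the (unique) real root of
`7x⁵ − 10x⁴ − 20x³ − 4`. The following are equivalent: (i) all complex roots of `f t`
are real (equivalently, the splitting field `K_t` of `f t` is totally real);
(ii) `(2−t)(7t⁵ − 10t⁴ − 20t³ − 4) > 0`; (iii) `2 < t < r`. -/
theorem totally_real_iff (t : ℚ) (h1 : t ≠ 1) (h2 : t ≠ 2)
    (r : ℝ) (hr : 7*r^5 - 10*r^4 - 20*r^3 - 4 = 0)
    (hr' : ∀ x : ℝ, 7*x^5 - 10*x^4 - 20*x^3 - 4 = 0 → x = r) :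
    ((∀ z : ℂ, Polynomial.aeval z (f t) = 0 → z.im = 0) ↔
      (2 - t) * (7*t^5 - 10*t^4 - 20*t^3 - 4) > 0) ∧
    ((2 - t) * (7*t^5 - 10*t^4 - 20*t^3 - 4) > 0 ↔ (2 < t ∧ (t : ℝ) < r)) := by
  have hp2 := part_two (t:ℝ) (by exact_mod_cast h2) r hr hr'
  have hcast : (2 - (t:ℝ)) * (7*(t:ℝ)^5 - 10*(t:ℝ)^4 - 20*(t:ℝ)^3 - 4) > 0 ↔
      (2 - t) * (7*t^5 - 10*t^4 - 20*t^3 - 4) > 0 := by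
    exact_mod_cast Iff.rfl
  rw [hcast] at hp2
  have hiii : (2 - t) * (7*t^5 - 10*t^4 - 20*t^3 - 4) > 0 ↔ (2 < t ∧ (t : ℝ) < r) := by
    rw [hp2]
    exact and_congr_left fun _ => by exact_mod_cast Iff.rfl
  refine ⟨⟨?_, ?_⟩, hiii⟩
  · intro hall
    by_contra hneg
    have hD := den_ne t
    have hQ := no_rat_root t
    have he : t - 2 ≠ 0 := sub_ne_zero.mpr h2
    have hpos : 0 < (t - 2) * (7*t^5 - 10*t^4 - 20*t^3 - 4) := by
      refine lt_of_le_of_ne ?_ (mul_ne_zero he hQ).symm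
      push Not at hneg
      linarith
    have g2 : 0 < 8 + 4*u t + 2*(v t-3) + (w t-2*u t) := by
      rw [g_two t h2]
      have : (7*t^5 - 10*t^4 - 20*t^3 - 4) / ((t-2)*(t^2+t-1)^2)
          = ((t - 2) * (7*t^5 - 10*t^4 - 20*t^3 - 4)) / ((t-2)^2*(t^2+t-1)^2) := by
        field_simp
      rw [this]
      positivity
    have gm2 : -8 + 4*u t - 2*(v t-3) + (w t-2*u t) < 0 := by
      rw [g_neg_two t h2, neg_div]
      have : 0 < (t-2)^4 / (t^2+t-1)^2 := by positivity
      linarith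
    obtain ⟨z, hz, hz'⟩ := core_nonreal (u t) (v t) (w t) (by exact_mod_cast g2)
      (by exact_mod_cast gm2)
    exact hz' (hall z (by rw [aeval_f]; exact hz))
  · intro hpos z hz
    rw [aeval_f] at hz
    obtain ⟨ht, -⟩ := hiii.mp hpos
    have hD : 0 < t^2 + t - 1 := by nlinarith
    have he : 0 < t - 2 := by linarith
    have hQ : 7*t^5 - 10*t^4 - 20*t^3 - 4 < 0 := by
      by_contra hq
      push Not at hq
      nlinarith
    have g2 : 8 + 4*u t + 2*(v t-3) + (w t-2*u t) < 0 := by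
      rw [g_two t h2]
      exact div_neg_of_neg_of_pos hQ (by positivity)
    have gm2 : -8 + 4*u t - 2*(v t-3) + (w t-2*u t) < 0 := by
      rw [g_neg_two t h2, neg_div]
      have : 0 < (t-2)^4 / (t^2+t-1)^2 := by positivity
      linarith
    have hu : 2 ≤ u t := by
      unfold u
      rw [le_div_iff₀ hD]
      nlinarith [sq_nonneg (t-2)]
    have hd : 0 ≤ 18*u t*(v t-3)*(w t-2*u t) - 4*u t^3*(w t-2*u t) + u t^2*(v t-3)^2
        - 4*(v t-3)^3 - 27*(w t-2*u t)^2 := by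
      rw [g_disc t h2]
      positivity
    exact core_real (u t) (v t) (w t) (by exact_mod_cast hu) (by exact_mod_cast g2)
      (by exact_mod_cast gm2) (by exact_mod_cast hd) z hz
end

section
/- There exist infinitely many subfields K of ℝ such that: K is a finite extension of ℚ of degree 6, K/ℚ is Galois with Galois group isomorphic to the symmetric group S₃ on three letters, and there exist x, y ∈ K with x⁵ + y⁵ + 1 = 0 and xy ≠ 0 (i.e. the Fermat quintic x⁵+y⁵+z⁵=0 has a non-trivial K-rational point). In particular there are infinitely many totally real Galois number fields of degree 6 with group S₃ over which the Fermat quintic has a non-trivial point. -/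
open Polynomial

noncomputable def fermatG (v : ℤ) : ℤ[X] :=
  X ^ 3 - C (5 * v * (v - 2)) * X ^ 2 + C (10 * v) * X + C (5 * v)

lemma fermatG_natDegree (v : ℤ) : (fermatG v).natDegree = 3 := by
  unfold fermatG; compute_degree!

lemma fermatG_monic (v : ℤ) : (fermatG v).Monic := by
  unfold fermatG; monicity!

lemma fermatG_irreducible (v : ℤ) (hv : ¬ (5:ℤ) ∣ v) : Irreducible (fermatG v) := by
  have h5 : Prime (5:ℤ) := Int.prime_iff_natAbs_prime.2 (by norm_num)
  have hP : (Ideal.span {(5:ℤ)}).IsPrime := (Ideal.span_singleton_prime (by norm_num)).2 h5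
  have hm := fermatG_monic v
  have hd := fermatG_natDegree v
  refine irreducible_of_eisenstein_criterion hP ?_ ?_ ?_ ?_ ?_
  · rw [hm.leadingCoeff, ← Ideal.ne_top_iff_one]; exact hP.ne_top
  · intro n hn
    have hn3 : n < 3 := by
      rw [degree_eq_natDegree hm.ne_zero, hd] at hn; exact_mod_cast hn
    rw [Ideal.mem_span_singleton]
    interval_cases n
    · simp [fermatG, coeff_X]
    · exact ⟨2 * v, by rw [fermatG]; simp only [coeff_add, coeff_sub, coeff_C_mul, coeff_X_pow, coeff_X, coeff_C]; norm_num; ring⟩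
    · exact ⟨-(v * (v - 2)), by
        rw [fermatG]
        simp only [coeff_add, coeff_sub, coeff_C_mul, coeff_X_pow, coeff_X, coeff_C]
        norm_num
        ring⟩
  · rw [degree_eq_natDegree hm.ne_zero, hd]; norm_num
  · rw [Ideal.span_singleton_pow, Ideal.mem_span_singleton]
    simp [fermatG, coeff_X]
    rintro ⟨k, hk⟩
    exact hv ⟨k, by linarith⟩
  · exact hm.isPrimitive

noncomputable def fermatQ (v : ℤ) : ℚ[X] := (fermatG v).map (Int.castRingHom ℚ)

lemma fermatQ_irreducible (v : ℤ) (hv : ¬ (5:ℤ) ∣ v) : Irreducible (fermatQ v) :=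
  ((fermatG_monic v).irreducible_iff_irreducible_map_fraction_map (K := ℚ)).1
    (fermatG_irreducible v hv)

lemma fermatQ_monic (v : ℤ) : (fermatQ v).Monic := (fermatG_monic v).map _
lemma fermatQ_natDegree (v : ℤ) : (fermatQ v).natDegree = 3 := by
  rw [fermatQ, (fermatG_monic v).natDegree_map, fermatG_natDegree]

lemma fermatQ_aeval {L : Type*} [Field L] [Algebra ℚ L] (v : ℤ) (y : L) :
    aeval y (fermatQ v) = y ^ 3 - 5 * v * (v - 2) * y ^ 2 + 10 * v * y + 5 * v := by
  rw [fermatQ, fermatG]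
  rw [aeval_def, eval₂_map]
  simp only [eval₂_add, eval₂_sub, eval₂_mul, eval₂_pow, eval₂_X, eval₂_C]
  simp

/-- three real roots -/
lemma exists_real_roots (v : ℤ) (hv : 5 < v) : ∃ a b c : ℝ, a < 0 ∧ 0 < b ∧ b < 1 ∧ 1 < c ∧
    (∀ y ∈ ({a, b, c} : Set ℝ), y ^ 3 - 5 * v * (v - 2) * y ^ 2 + 10 * v * y + 5 * v = 0) := by
  have hv' : (6:ℝ) ≤ v := by exact_mod_cast hv
  set f : ℝ → ℝ := fun y => y ^ 3 - 5 * v * (v - 2) * y ^ 2 + 10 * v * y + 5 * v with hf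
  have hc : Continuous f := by fun_prop
  have h0 : 0 < f 0 := by simp [hf]; linarith
  have hm1 : f (-1) < 0 := by simp [hf]; nlinarith
  have h1 : f 1 < 0 := by simp [hf]; nlinarith
  have hbig : 0 < f (5 * v ^ 2) := by
    have : f (5 * v^2) = 250 * (v:ℝ)^5 + 50 * v^3 + 5 * v := by simp only [hf]; ring
    rw [this]; positivity
  obtain ⟨a, ha, ha'⟩ := intermediate_value_Ioo (by norm_num : (-1:ℝ) ≤ 0) hc.continuousOn ⟨hm1, h0⟩
  obtain ⟨b, hb, hb'⟩ := intermediate_value_Ioo' (by norm_num : (0:ℝ) ≤ 1) hc.continuousOn ⟨h1, h0⟩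
  obtain ⟨c, hc1, hc'⟩ := intermediate_value_Ioo (by nlinarith : (1:ℝ) ≤ 5 * v^2) hc.continuousOn
    ⟨h1, hbig⟩
  refine ⟨a, b, c, ha.2, hb.1, hb.2, hc1.1, ?_⟩
  rintro y (rfl | rfl | rfl) <;> assumption

lemma vieta {F : Type*} [Field F] {a b c r s t : F} (hab : a ≠ b) (hac : a ≠ c) (hbc : b ≠ c)
    (ha : a ^ 3 - r * a ^ 2 + s * a + t = 0) (hb : b ^ 3 - r * b ^ 2 + s * b + t = 0)
    (hc : c ^ 3 - r * c ^ 2 + s * c + t = 0) :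
    a + b + c = r ∧ a * b + b * c + c * a = s ∧ a * b * c = -t := by
  have h1 : a^2 + a*b + b^2 - r * (a + b) + s = 0 :=
    mul_left_cancel₀ (sub_ne_zero.2 hab) (by linear_combination ha - hb)
  have h2 : a^2 + a*c + c^2 - r * (a + c) + s = 0 :=
    mul_left_cancel₀ (sub_ne_zero.2 hac) (by linear_combination ha - hc)
  have h3 : a + b + c - r = 0 :=
    mul_left_cancel₀ (sub_ne_zero.2 hbc) (by linear_combination h1 - h2)
  have h4 : a * b + b * c + c * a = s := by linear_combination (a + b) * h3 - h1
  refine ⟨sub_eq_zero.1 h3, h4, ?_⟩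
  linear_combination ha - a * a * h3 + a * h4

/-- the Fermat point -/
lemma fermat_point {F : Type*} [Field F] [CharZero F] (v : ℤ) (hv : v ≠ 0) {a b c : F}
    (h1 : a + b + c = 5 * v * (v - 2)) (h2 : a * b + b * c + c * a = 10 * v)
    (h3 : a * b * c = -(5 * v)) :
    ∃ x y : F, x ^ 5 + y ^ 5 + 1 = 0 ∧ x * y ≠ 0 := by
  have hv' : (v : F) ≠ 0 := by exact_mod_cast hv
  have habc : a * b * c ≠ 0 := by rw [h3]; simp [hv']
  have ha : a ≠ 0 := by rintro rfl; simp at habc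
  have hb : b ≠ 0 := by rintro rfl; simp at habc
  have hc : c ≠ 0 := by rintro rfl; simp at habc
  have hprod : (1 + a) * (1 + b) * (1 + c) ≠ 0 := by
    have : (1 + a) * (1 + b) * (1 + c) = ((1 + 5 * v * (v - 1) : ℤ) : F) := by
      push_cast; linear_combination h1 + h2 + h3
    rw [this]
    norm_cast
    intro h
    have : (5:ℤ) ∣ 1 := ⟨-(v * (v-1)), by linarith⟩
    norm_num at this
  have e1 : (1 + a) / a + (1 + b) / b + (1 + c) / c = 1 := by
    field_simp
    linear_combination h2 + 2 * h3
  have e2 : (1 + a) / a * ((1 + b) / b) + (1 + b) / b * ((1 + c) / c) + (1 + c) / c * ((1 + a) / a)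
      = 1 - v := by
    field_simp
    linear_combination h1 + 2 * h2 + (2 + v) * h3
  have e3 : ((1 + a) / a) * ((1 + b) / b) * ((1 + c) / c) * (5 * v) = - (1 + 5 * v * (v - 1)) := by
    field_simp
    linear_combination (5 * v) * (h1 + h2) + (5 * v + 1 + 5 * v * (v - 1)) * h3
  have ta : (1 + a) / a ≠ 0 := div_ne_zero (fun h => hprod (by rw [h]; ring)) ha
  have tb : (1 + b) / b ≠ 0 := div_ne_zero (fun h => hprod (by rw [h]; ring)) hb
  have tc : (1 + c) / c ≠ 0 := div_ne_zero (fun h => hprod (by rw [h]; ring)) hc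
  generalize (1 + a) / a = p at *
  generalize (1 + b) / b = q at *
  generalize (1 + c) / c = r at *
  have key : p ^ 5 + q ^ 5 + r ^ 5 = 0 := by
    have hr : r = 1 - p - q := by linear_combination e1
    subst hr
    have : (v : F) = 1 - (p * q + q * (1 - p - q) + (1 - p - q) * p) := by linear_combination e2
    rw [this] at e3
    linear_combination e3
  refine ⟨p / r, q / r, ?_, mul_ne_zero (div_ne_zero ta tc) (div_ne_zero tb tc)⟩
  field_simp
  linear_combination key

lemma disc_id {F : Type*} [Field F] (v : ℤ) {a b c : F}
    (h1 : a + b + c = 5 * v * (v - 2)) (h2 : a * b + b * c + c * a = 10 * v)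
    (h3 : a * b * c = -(5 * v)) :
    ((a - b) * (b - c) * (c - a)) ^ 2 =
      25 * v ^ 2 * (((100 * v^2 * (v - 1) * (v - 2)^2 - 180 * v^2 + 200 * v - 27) : ℤ) : F) := by
  have : ((a - b) * (b - c) * (c - a)) ^ 2 = (a+b+c)^2*(a * b + b * c + c * a)^2
    - 4 * (a * b + b * c + c * a)^3 - 4 * (a+b+c)^3*(a*b*c)
    + 18 * (a+b+c) * (a * b + b * c + c * a) * (a*b*c) - 27 * (a*b*c)^2 := by ring
  rw [this, h1, h2, h3]; push_cast; ring

lemma disc_not_sq (v : ℤ) (q : ℚ) :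
    q ^ 2 ≠ ((100 * v^2 * (v - 1) * (v - 2)^2 - 180 * v^2 + 200 * v - 27 : ℤ) : ℚ) := by
  intro h
  set D := (100 * v^2 * (v - 1) * (v - 2)^2 - 180 * v^2 + 200 * v - 27 : ℤ) with hD
  have : IsSquare ((D : ℤ) : ℚ) := ⟨q, by rw [← h]; ring⟩
  rw [Rat.isSquare_intCast_iff] at this
  obtain ⟨m, hm⟩ := this
  have h2 : (m * m) % 5 = 3 := by
    have : m * m = 5 * (20 * v^2 * (v - 1) * (v - 2)^2 - 36 * v^2 + 40 * v - 6) + 3 := by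
      rw [← hm, hD]; ring
    omega
  have : m % 5 = 0 ∨ m % 5 = 1 ∨ m % 5 = 2 ∨ m % 5 = 3 ∨ m % 5 = 4 := by omega
  rcases this with h | h | h | h | h <;> simp [Int.mul_emod, h] at h2

/-- ramification -/
lemma prime_dvd_discr (K : Type*) [Field K] [NumberField K] (p : ℕ) (hp : p.Prime) (h5 : 5 < p)
    (y : K) (hy : y ^ 3 - 5 * p * (p - 2) * y ^ 2 + 10 * p * y + 5 * p = 0) :
    (p : ℤ) ∣ NumberField.discr K := by
  have hpp : Prime (p : ℤ) := Nat.prime_iff_prime_int.1 hp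
  by_contra hnd
  rw [NumberField.not_dvd_discr_iff_forall_mem K (NumberField.RingOfIntegers K) hpp] at hnd
  have hint : IsIntegral ℤ y := by
    refine ⟨X ^ 3 - C (5 * p * (p - 2) : ℤ) * X ^ 2 + C (10 * p : ℤ) * X + C (5 * p : ℤ), ?_, ?_⟩
    · monicity!
    · simpa using hy
  obtain ⟨z, rfl⟩ : ∃ z : NumberField.RingOfIntegers K, (z : K) = y := ⟨⟨y, hint⟩, rfl⟩
  have hz : z ^ 3 - 5 * p * (p - 2) * z ^ 2 + 10 * p * z + 5 * p = 0 := by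
    apply NumberField.RingOfIntegers.ext
    simp only [map_add, map_sub, map_mul, map_pow, map_ofNat, map_natCast, map_zero]
    exact hy
  have hsp : (Ideal.span {(p : ℤ)}).IsPrime := (Ideal.span_singleton_prime hpp.ne_zero).2 hpp
  have hsm : (Ideal.span {(p : ℤ)}).IsMaximal := hsp.isMaximal (by simpa using hpp.ne_zero)
  obtain ⟨P, hP, hover⟩ := Ideal.exists_maximal_ideal_liesOver_of_isIntegral
    (Ideal.span {(p : ℤ)}) (S := NumberField.RingOfIntegers K)
  have hPp := hP.isPrime
  have hpP : (p : NumberField.RingOfIntegers K) ∈ P := by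
    simpa using (Ideal.liesOver_span_iff hPp.ne_top hpp).mp hover
  have hun := hnd P hPp (by simpa using hpP)
  have hzP : z ∈ P := by
    refine hPp.mem_of_pow_mem 3 ?_
    have : z ^ 3 = p * (5 * (p - 2) * z ^ 2 - 10 * z - 5) := by linear_combination hz
    rw [this]; exact P.mul_mem_right _ hpP
  have hp2 : (p : NumberField.RingOfIntegers K) ∈ P ^ 2 := by
    have h5p : (5 * p : NumberField.RingOfIntegers K) ∈ P ^ 2 := by
      have : (5 * p : NumberField.RingOfIntegers K) =
          (z * z) * (-z) + (p * z) * (5 * (p - 2) * z - 10) := by linear_combination hz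
      rw [this, pow_two]
      exact add_mem (Ideal.mul_mem_right _ _ (Ideal.mul_mem_mul hzP hzP))
        (Ideal.mul_mem_right _ _ (Ideal.mul_mem_mul hpP hzP))
    have hcop : IsCoprime (5 : ℤ) (p : ℤ) := by
      rw [Int.isCoprime_iff_gcd_eq_one]
      have := (Nat.coprime_primes (by norm_num : Nat.Prime 5) hp).2 (by omega)
      exact_mod_cast this
    obtain ⟨s, t, hst⟩ := hcop
    have hst' : (s : NumberField.RingOfIntegers K) * 5 + t * p = 1 := by exact_mod_cast hst
    have : (p : NumberField.RingOfIntegers K) = s * (5 * p) + t * (p * p) := by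
      linear_combination - (p : NumberField.RingOfIntegers K) * hst'
    rw [this]
    refine add_mem (Ideal.mul_mem_left _ _ h5p) (Ideal.mul_mem_left _ _ ?_)
    rw [pow_two]; exact Ideal.mul_mem_mul hpP hpP
  have hbot : P ≠ ⊥ := by
    rintro rfl
    have : (p : NumberField.RingOfIntegers K) = 0 := by simpa using hpP
    exact hp.ne_zero (by exact_mod_cast this)
  have hle : Ideal.map (algebraMap ℤ (NumberField.RingOfIntegers K)) (Ideal.span {(p : ℤ)}) ≤ P ^ 2 := by
    rw [Ideal.map_span, Ideal.span_le]; simpa using hp2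
  have hle1 := hle.trans (Ideal.pow_le_self two_ne_zero)
  let := Localization.AtPrime.algebraOfLiesOver (Ideal.span {(p : ℤ)}) P
  have hmap := ((Algebra.isUnramifiedAt_iff_map_eq ℤ (Ideal.span {(p : ℤ)}) P).1 hun).2
  have h1 := Ideal.ramificationIdx'_eq_one_of_map_localization hle1 hbot
    P.primeCompl_le_nonZeroDivisors hmap
  exact (Ideal.ramificationIdx'_ne_one_iff hle1).2 hle h1

lemma finrank_even {K : Type*} [Field K] [Algebra ℚ K] [FiniteDimensional ℚ K] (D : ℤ)
    (hD : ∀ q : ℚ, q ^ 2 ≠ (D : ℚ)) (s : K) (hs : s ^ 2 = (D : K)) : 2 ∣ Module.finrank ℚ K := by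
  have hirr : Irreducible (X ^ 2 - C (D : ℚ)) := by
    refine X_pow_sub_C_irreducible_of_prime Nat.prime_two ?_
    exact hD
  have hmin : minpoly ℚ s = X ^ 2 - C (D : ℚ) := by
    refine (minpoly.eq_of_irreducible_of_monic hirr ?_ (by monicity!)).symm
    simp [hs]
  have := minpoly.degree_dvd (K := ℚ) (x := s) (.of_finite ℚ s)
  rwa [hmin, natDegree_X_pow_sub_C] at this

lemma fermat_field (v : ℤ) (hv : 5 < v) (hv5 : ¬ (5:ℤ) ∣ v) :
    ∃ K : IntermediateField ℚ ℝ, (Module.finrank ℚ K = 6 ∧ IsGalois ℚ K ∧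
        Nonempty ((K ≃ₐ[ℚ] K) ≃* Equiv.Perm (Fin 3)) ∧
        ∃ x y : K, x^5 + y^5 + 1 = 0 ∧ x * y ≠ 0) ∧
      ∃ y : K, y ^ 3 - 5 * v * (v - 2) * y ^ 2 + 10 * v * y + 5 * v = 0 := by
  obtain ⟨a, b, c, ha0, hb0, hb1, hc1, hroots⟩ := exists_real_roots v hv
  have hab : a ≠ b := (ha0.trans hb0).ne
  have hbc : b ≠ c := (hb1.trans hc1).ne
  have hac : a ≠ c := ((ha0.trans hb0).trans (hb1.trans hc1)).ne
  have ha := hroots a (by simp)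
  have hb := hroots b (by simp)
  have hc := hroots c (by simp)
  obtain ⟨e1, e2, e3⟩ := vieta hab hac hbc ha hb hc
  set f := fermatQ v with hf
  have hirr : Irreducible f := fermatQ_irreducible v hv5
  have hsep : f.Separable := hirr.separable
  have hmon : f.Monic := fermatQ_monic v
  have hdeg : f.natDegree = 3 := fermatQ_natDegree v
  have hfac : f.map (algebraMap ℚ ℝ) = (X - C a) * (X - C b) * (X - C c) := by
    refine Polynomial.funext fun y => ?_
    rw [eval_map_algebraMap, hf, fermatQ_aeval]
    simp only [eval_mul, eval_sub, eval_X, eval_C]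
    linear_combination y ^ 2 * e1 - y * e2 + e3
  have hspl : (f.map (algebraMap ℚ ℝ)).Splits := by
    rw [hfac]
    exact ((Splits.X_sub_C a).mul (Splits.X_sub_C b)).mul (Splits.X_sub_C c)
  let K := IntermediateField.adjoin ℚ (f.rootSet ℝ)
  have hK : f.IsSplittingField ℚ K := IntermediateField.adjoin_rootSet_isSplittingField hspl
  have : FiniteDimensional ℚ K := IsSplittingField.finiteDimensional K f
  have hgal : IsGalois ℚ K := IsGalois.of_separable_splitting_field hsep
  have mem : ∀ y : ℝ, y ^ 3 - 5 * v * (v - 2) * y ^ 2 + 10 * v * y + 5 * v = 0 → y ∈ K := by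
    intro y hy
    refine IntermediateField.subset_adjoin _ _ ?_
    rw [mem_rootSet]
    exact ⟨hmon.ne_zero, by rw [hf, fermatQ_aeval]; exact hy⟩
  let A : K := ⟨a, mem a ha⟩
  let B : K := ⟨b, mem b hb⟩
  let Cc : K := ⟨c, mem c hc⟩
  have hinj : Function.Injective (algebraMap K ℝ) := (algebraMap K ℝ).injective
  have E1 : A + B + Cc = 5 * v * (v - 2) := hinj (by
    simp only [map_add, map_sub, map_mul, map_pow, map_neg, map_ofNat, map_intCast, map_zero]
    exact e1)
  have E2 : A * B + B * Cc + Cc * A = 10 * v := hinj (by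
    simp only [map_add, map_sub, map_mul, map_pow, map_neg, map_ofNat, map_intCast, map_zero]
    exact e2)
  have E3 : A * B * Cc = -(5 * v) := hinj (by
    simp only [map_add, map_sub, map_mul, map_pow, map_neg, map_ofNat, map_intCast, map_zero]
    exact e3)
  have hv0 : (v : K) ≠ 0 := by exact_mod_cast (by omega : v ≠ 0)
  have h2 : 2 ∣ Module.finrank ℚ K := by
    refine finrank_even _ (disc_not_sq v) ((A - B) * (B - Cc) * (Cc - A) / (5 * v)) ?_
    rw [div_pow, disc_id v E1 E2 E3]
    field_simp
    ring
  let e : K ≃ₐ[ℚ] f.SplittingField := IsSplittingField.algEquiv K f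
  have hcard : Nat.card f.Gal = Module.finrank ℚ K := by
    rw [Gal.card_of_separable hsep, e.toLinearEquiv.finrank_eq]
  have h3 : 3 ∣ Module.finrank ℚ K := by
    rw [← hcard, ← hdeg]
    exact Gal.prime_degree_dvd_card hirr (by rw [hdeg]; norm_num)
  have : Fact ((f.map (algebraMap ℚ ℝ)).Splits) := ⟨hspl⟩
  have hcr : Nat.card (f.rootSet ℝ) = 3 := by
    rw [Nat.card_eq_fintype_card, card_rootSet_eq_natDegree hsep hspl, hdeg]
  have hperm : Nat.card (Equiv.Perm (f.rootSet ℝ)) = 6 := by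
    rw [Nat.card_perm, hcr]; rfl
  have hGinj := Gal.galActionHom_injective f ℝ
  have hle : Nat.card f.Gal ≤ 6 := hperm ▸ Nat.card_le_card_of_injective _ hGinj
  have hpos : 0 < Module.finrank ℚ K := Module.finrank_pos
  have h6 : Module.finrank ℚ K = 6 := by omega
  have hbij : Function.Bijective (Gal.galActionHom f ℝ) :=
    (Nat.bijective_iff_injective_and_card _).2 ⟨hGinj, by rw [hperm, hcard, h6]⟩
  have eq3 : f.rootSet ℝ ≃ Fin 3 := (Finite.equivFin _).trans (finCongr hcr)
  refine ⟨K, ⟨h6, hgal, ⟨?_⟩, fermat_point v (by omega) E1 E2 E3⟩, A, hinj (by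
    simp only [map_add, map_sub, map_mul, map_pow, map_neg, map_ofNat, map_intCast, map_zero]
    exact ha)⟩
  exact ((AlgEquiv.autCongr e).trans (MulEquiv.ofBijective _ hbij)).trans (Equiv.permCongrHom eq3)


/-- There exist infinitely many subfields `K` of `ℝ` such that `K/ℚ` is a Galois
extension of degree `6` with Galois group isomorphic to `S₃`, and the Fermat quintic
`x⁵ + y⁵ + z⁵ = 0` has a non-trivial `K`-rational point (i.e. there are `x, y ∈ K` with
`x⁵ + y⁵ + 1 = 0` and `xy ≠ 0`). Such fields are totally real number fields. -/
theorem infinitely_many_totally_real_S3_fields_with_fermat_point :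
    {K : IntermediateField ℚ ℝ |
      Module.finrank ℚ K = 6 ∧ IsGalois ℚ K ∧
        Nonempty ((K ≃ₐ[ℚ] K) ≃* Equiv.Perm (Fin 3)) ∧
        ∃ x y : K, x^5 + y^5 + 1 = 0 ∧ x * y ≠ 0}.Infinite := by
  intro hfin
  set S := {K : IntermediateField ℚ ℝ |
      Module.finrank ℚ K = 6 ∧ IsGalois ℚ K ∧
        Nonempty ((K ≃ₐ[ℚ] K) ≃* Equiv.Perm (Fin 3)) ∧
        ∃ x y : K, x^5 + y^5 + 1 = 0 ∧ x * y ≠ 0} with hS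
  -- Each field in `S` contains roots for only finitely many primes.
  have hex : ∀ K ∈ S, ∃ N : ℕ, ∀ p : ℕ, p.Prime → 5 < p →
      (∃ y : K, y ^ 3 - 5 * p * (p - 2) * y ^ 2 + 10 * p * y + 5 * p = 0) → p ≤ N := by
    intro K hK
    have : FiniteDimensional ℚ K := Module.finite_of_finrank_pos (by rw [hK.1]; norm_num)
    have : NumberField K := ⟨⟩
    refine ⟨(NumberField.discr K).natAbs, fun p hp h5 ⟨y, hy⟩ => ?_⟩
    have := prime_dvd_discr K p hp h5 y hy
    exact Nat.le_of_dvd (Int.natAbs_pos.2 (NumberField.discr_ne_zero K)) (Int.natCast_dvd.1 this)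
  choose! N hN using hex
  obtain ⟨M, hM⟩ := (hfin.image N).bddAbove
  obtain ⟨p, hpM, hp⟩ := Nat.exists_infinite_primes (M + 6)
  have h5 : ¬ (5:ℤ) ∣ (p:ℤ) := by
    intro h
    have h' : 5 ∣ p := by exact_mod_cast h
    have := (Nat.prime_dvd_prime_iff_eq (by norm_num) hp).1 h'
    omega
  obtain ⟨K, hK, y, hy⟩ := fermat_field p (by omega) h5
  have h1 := hN K hK p hp (by omega) ⟨y, by simpa using hy⟩
  have h2 := hM ⟨K, hK, rfl⟩
  omega
end
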